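/- arXiv:math/9412214 — 3 statements merged into one kernel-verified Lean document; each statement's English description precedes it below -/
import Mathlib

section
/- Let X be a rearrangement invariant quasi-Banach space on ℝ, and let 0 < p < ∞ and 0 < r < ∞. If the lower Boyd index satisfies p_X > p, then the Hardy operator H^{(p,r)} is bounded from X to X; that is, there exists a constant c > 0 such that ‖H^{(p,r)} f‖_X ≤ c ‖f‖_X for all f ∈ X. -/
open MeasureTheory Set Filter Topology ENNReal

noncomputable section

/-- The decreasing rearrangement of an `ℝ≥0∞`-valued function with respect to a measure `μ`:
`g⁎(s) = sup {t : μ {x | g x > t} > s}`. -/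
def distRearr {α : Type*} [MeasurableSpace α] (μ : Measure α) (g : α → ℝ≥0∞) (s : ℝ) : ℝ≥0∞ :=
  sSup {t : ℝ≥0∞ | ENNReal.ofReal s < μ {x | t < g x}}

/-- Decreasing rearrangement of an `ℝ≥0∞`-valued function on `ℝ` (Lebesgue measure). -/
def rearrE (g : ℝ → ℝ≥0∞) : ℝ → ℝ≥0∞ := distRearr (volume : Measure ℝ) g

/-- Decreasing rearrangement `f^*` of a real-valued function on `ℝ`:
`f^*(s) = sup {t ≥ 0 : volume {x : |f x| > t} > s}`. -/
def rearr (f : ℝ → ℝ) : ℝ → ℝ≥0∞ := rearrE fun x => ENNReal.ofReal |f x|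

/-- The dilation operator `D_a f (t) = f (a t)`. -/
def dil (a : ℝ) (f : ℝ → ℝ) : ℝ → ℝ := fun t => f (a * t)

/-- The dilation operator on `ℝ≥0∞`-valued functions. -/
def dilE (a : ℝ) (g : ℝ → ℝ≥0∞) : ℝ → ℝ≥0∞ := fun t => g (a * t)

/-- A rearrangement invariant quasi-Banach function space on `ℝ` (with Lebesgue measure).
The quasi-norm `N` is defined on all `ℝ≥0∞`-valued functions (a signed function `f`
is measured via `|f|`, embedded into `ℝ≥0∞`; this is harmless since the quasi-norm of a
rearrangement invariant space depends only on `|f|`).  Membership of a signed function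
`f` in the space means `f` is measurable with `N (|f|) < ∞`. -/
structure RIQB where
  /-- the quasi-norm -/
  N : (ℝ → ℝ≥0∞) → ℝ≥0∞
  /-- the quasi-triangle inequality constant -/
  C : ℝ
  one_le_C : 1 ≤ C
  /-- homogeneity of the quasi-norm -/
  norm_smul : ∀ (c : ℝ≥0∞) (g : ℝ → ℝ≥0∞), N (fun x => c * g x) = c * N g
  /-- the quasi-triangle inequality -/
  quasi_triangle : ∀ g h : ℝ → ℝ≥0∞, AEMeasurable g volume → AEMeasurable h volume →
    N (fun x => g x + h x) ≤ ENNReal.ofReal C * (N g + N h)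
  /-- definiteness (functions are identified a.e.) -/
  definite : ∀ g : ℝ → ℝ≥0∞, AEMeasurable g volume → (N g = 0 ↔ g =ᵐ[volume] 0)
  /-- property (i): if `h^* ≤ g^*` then `‖h‖ ≤ ‖g‖` -/
  rearr_mono : ∀ g h : ℝ → ℝ≥0∞, AEMeasurable g volume → AEMeasurable h volume →
    (∀ s : ℝ, 0 < s → rearrE h s ≤ rearrE g s) → N h ≤ N g
  /-- property (ii): simple functions with support of finite measure belong to the space -/
  simple_mem : ∀ f : MeasureTheory.SimpleFunc ℝ ℝ,
    volume (Function.support (f : ℝ → ℝ)) < ∞ → N (fun x => ENNReal.ofReal |f x|) < ∞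
  /-- property (iii) or (iii′) -/
  fatou :
    (∀ g : ℕ → ℝ → ℝ≥0∞, (∀ n, AEMeasurable (g n) volume ∧ N (g n) < ∞) →
      (∀ x, Antitone fun n => g n x) → (∀ x, Tendsto (fun n => g n x) atTop (𝓝 0)) →
      Tendsto (fun n => N (g n)) atTop (𝓝 0)) ∨
    (∀ (g : ℕ → ℝ → ℝ≥0∞) (h : ℝ → ℝ≥0∞),
      (∀ n, AEMeasurable (g n) volume ∧ N (g n) < ∞) →
      (∀ x, Monotone fun n => g n x) → (∀ x, Tendsto (fun n => g n x) atTop (𝓝 (h x))) →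
      (⨆ n, N (g n)) < ∞ → N h = ⨆ n, N (g n))
  /-- completeness of the quasi-norm -/
  complete : ∀ f : ℕ → ℝ → ℝ,
    (∀ n, AEMeasurable (f n) volume ∧ N (fun x => ENNReal.ofReal |f n x|) < ∞) →
    (∀ ε : ℝ, 0 < ε → ∃ M : ℕ, ∀ m ≥ M, ∀ n ≥ M,
      N (fun x => ENNReal.ofReal |f m x - f n x|) < ENNReal.ofReal ε) →
    ∃ g : ℝ → ℝ, AEMeasurable g volume ∧ N (fun x => ENNReal.ofReal |g x|) < ∞ ∧
      Tendsto (fun n => N (fun x => ENNReal.ofReal |f n x - g x|)) atTop (𝓝 0)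

/-- The quasi-norm of a signed function. -/
def RIQB.Nr (X : RIQB) (f : ℝ → ℝ) : ℝ≥0∞ := X.N fun x => ENNReal.ofReal |f x|

/-- Membership in the space. -/
def RIQB.mem (X : RIQB) (f : ℝ → ℝ) : Prop := AEMeasurable f volume ∧ X.Nr f < ∞

/-- The lower Boyd index of a quasi-norm functional:
`sup {p > 0 : ∃ c > 0, ∀ 0 < a < 1, ∀ f ∈ X, ‖D_a f‖ ≤ c a^(-1/p) ‖f‖}`. -/
def lowerBoydOf (N : (ℝ → ℝ) → ℝ≥0∞) : ℝ≥0∞ :=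
  ⨆ p ∈ {p : ℝ | 0 < p ∧ ∃ c : ℝ, 0 < c ∧ ∀ a : ℝ, 0 < a → a < 1 →
      ∀ f : ℝ → ℝ, AEMeasurable f volume → N f < ∞ →
        N (dil a f) ≤ ENNReal.ofReal (c * a ^ (-(1/p))) * N f},
    ENNReal.ofReal p

/-- The upper Boyd index of a quasi-norm functional:
`inf {q > 0 : ∃ c > 0, ∀ a > 1, ∀ f ∈ X, ‖D_a f‖ ≤ c a^(-1/q) ‖f‖}`. -/
def upperBoydOf (N : (ℝ → ℝ) → ℝ≥0∞) : ℝ≥0∞ :=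
  ⨅ q ∈ {q : ℝ | 0 < q ∧ ∃ c : ℝ, 0 < c ∧ ∀ a : ℝ, 1 < a →
      ∀ f : ℝ → ℝ, AEMeasurable f volume → N f < ∞ →
        N (dil a f) ≤ ENNReal.ofReal (c * a ^ (-(1/q))) * N f},
    ENNReal.ofReal q

/-- The lower Boyd index `p_X`. -/
def lowerBoyd (X : RIQB) : ℝ≥0∞ := lowerBoydOf X.Nr

/-- The upper Boyd index `q_X`. -/
def upperBoyd (X : RIQB) : ℝ≥0∞ := upperBoydOf X.Nr

/-- The Hardy operator `H^{(p,r)}` acting on a nonnegative (`ℝ≥0∞`-valued) function: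
`t^{-1/p} ((r/p) ∫₀ᵗ g(s)^r s^{r/p-1} ds)^{1/r}` for `t > 0`, and `0` for `t ≤ 0`. -/
def hardyUE (p r : ℝ) (g : ℝ → ℝ≥0∞) : ℝ → ℝ≥0∞ := fun t =>
  if 0 < t then
    ENNReal.ofReal t ^ (-(1/p)) *
      (ENNReal.ofReal (r/p) *
        ∫⁻ s in Ioo (0:ℝ) t, g s ^ r * ENNReal.ofReal (s ^ (r/p - 1))) ^ (1/r)
  else 0

/-- The Hardy operator `H^{(p,r)} f (t) = t^{-1/p} ((r/p) ∫₀ᵗ f^*(s)^r s^{r/p-1} ds)^{1/r}`. -/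
def hardyU (p r : ℝ) (f : ℝ → ℝ) : ℝ → ℝ≥0∞ := hardyUE p r (rearr f)

/-- The Hardy operator `H^{(p,∞)} f (t) = sup_{0<s<t} (s/t)^{1/p} f^*(s)`. -/
def hardyUSup (p : ℝ) (f : ℝ → ℝ) : ℝ → ℝ≥0∞ := fun t =>
  if 0 < t then ⨆ s ∈ Ioo (0:ℝ) t, ENNReal.ofReal ((s/t) ^ (1/p)) * rearr f s else 0

/-- The Hardy operator
`H_{(q,r)} f (t) = t^{-1/q} ((r/q) ∫_t^∞ f^*(s)^r s^{r/q-1} ds)^{1/r}` for finite `q`. -/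
def hardyL (q r : ℝ) (f : ℝ → ℝ) : ℝ → ℝ≥0∞ := fun t =>
  if 0 < t then
    ENNReal.ofReal t ^ (-(1/q)) *
      (ENNReal.ofReal (r/q) *
        ∫⁻ s in Ioi t, rearr f s ^ r * ENNReal.ofReal (s ^ (r/q - 1))) ^ (1/r)
  else 0

/-- The Hardy operator `H_{(∞,r)} f (t) = (∫_t^∞ f^*(s)^r s⁻¹ ds)^{1/r}`. -/
def hardyLInf (r : ℝ) (f : ℝ → ℝ) : ℝ → ℝ≥0∞ := fun t =>
  if 0 < t then (∫⁻ s in Ioi t, rearr f s ^ r * ENNReal.ofReal s⁻¹) ^ (1/r) else 0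

/-- The Hardy operator `H_{(q,r)}` for `0 < q ≤ ∞`, `0 < r < ∞`. -/
def hardyLG (q : ℝ≥0∞) (r : ℝ) (f : ℝ → ℝ) : ℝ → ℝ≥0∞ :=
  if q = ∞ then hardyLInf r f else hardyL q.toReal r f

/-- The Hardy operator `H_{(q,∞)} f (t) = sup_{s>t} (s/t)^{1/q} f^*(s)`. -/
def hardyLSup (q : ℝ) (f : ℝ → ℝ) : ℝ → ℝ≥0∞ := fun t =>
  if 0 < t then ⨆ s ∈ Ioi t, ENNReal.ofReal ((s/t) ^ (1/q)) * rearr f s else 0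

/-- The Hardy operator `H^{(p,r)}` for `0 < p < ∞`, `0 < r ≤ ∞`. -/
def hardyUG (p : ℝ) (r : ℝ≥0∞) (f : ℝ → ℝ) : ℝ → ℝ≥0∞ :=
  if r = ∞ then hardyUSup p f else hardyU p r.toReal f

/-- The Hardy operator `H_{(q,s)}` for `0 < q ≤ ∞`, `0 < s ≤ ∞`
(with `H_{(∞,∞)} f = f^*`). -/
def hardyLGG (q s : ℝ≥0∞) (f : ℝ → ℝ) : ℝ → ℝ≥0∞ :=
  if q = ∞ then
    (if s = ∞ then (fun t => if 0 < t then rearr f t else 0) else hardyLInf s.toReal f)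
  else
    (if s = ∞ then hardyLSup q.toReal f else hardyL q.toReal s.toReal f)

/-- The Lorentz quasi-norm `‖f‖_{p,r}` for `0 < p ≤ ∞`, `0 < r ≤ ∞`. -/
def lorentz (p r : ℝ≥0∞) (f : ℝ → ℝ) : ℝ≥0∞ :=
  if p = ∞ then
    (if r = ∞ then essSup (fun x => ENNReal.ofReal |f x|) volume
     else (∫⁻ t in Ioi (0:ℝ), rearr f t ^ r.toReal * ENNReal.ofReal t⁻¹) ^ (1/r.toReal))
  else
    (if r = ∞ then ⨆ t ∈ Ioi (0:ℝ), ENNReal.ofReal t ^ (1/p.toReal) * rearr f t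
     else (∫⁻ t in Ioi (0:ℝ),
        (ENNReal.ofReal t ^ (1/p.toReal) * rearr f t) ^ r.toReal * ENNReal.ofReal t⁻¹) ^
          (1/r.toReal))

/-- The weak-`L_p` (Lorentz `(p,∞)`) quasi-norm of an `ℝ≥0∞`-valued function on `ℝ`:
`sup_{t>0} t^{1/p} g^*(t)`. -/
def lorentzWE (p : ℝ) (g : ℝ → ℝ≥0∞) : ℝ≥0∞ :=
  ⨆ t ∈ Ioi (0:ℝ), ENNReal.ofReal t ^ (1/p) * rearrE g t

lemma antitone_rearrE (g : ℝ → ℝ≥0∞) : Antitone (rearrE g) := by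
  intro a b hab
  exact sSup_le_sSup fun t ht => (ENNReal.ofReal_le_ofReal hab).trans_lt ht

lemma rearrE_mono_ae {g h : ℝ → ℝ≥0∞} (hgh : h ≤ᵐ[volume] g) (s : ℝ) :
    rearrE h s ≤ rearrE g s := by
  refine sSup_le_sSup fun t (ht : ENNReal.ofReal s < _) => ht.trans_le ?_
  refine measure_mono_ae ?_
  filter_upwards [hgh] with x hx (hxt : t < h x)
  exact hxt.trans_le hx

/-- An antitone function restricted to `(0, ∞)` dominates its own rearrangement. -/
lemma rearrE_indicator_le {g : ℝ → ℝ≥0∞} (hg : Antitone g) (s : ℝ) :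
    rearrE ((Ioi 0).indicator g) s ≤ g s := by
  refine sSup_le fun t (ht : ENNReal.ofReal s < _) => ?_
  by_contra! hlt
  refine ht.not_ge ?_
  have hsub : {x | t < (Ioi 0).indicator g x} ⊆ Ioo 0 s := by
    intro x (hx : t < _)
    have hx0 : x ∈ Ioi (0 : ℝ) := by
      by_contra hx0
      simp [indicator_of_notMem hx0] at hx
    rw [indicator_of_mem hx0] at hx
    refine ⟨hx0, ?_⟩
    by_contra! hsx
    exact (hx.trans_le (hg hsx)).not_gt hlt
  simpa using measure_mono (μ := volume) hsub

namespace RIQB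

variable (X : RIQB)

lemma N_mono_ae {g h : ℝ → ℝ≥0∞} (hg : AEMeasurable g volume) (hh : AEMeasurable h volume)
    (hgh : h ≤ᵐ[volume] g) : X.N h ≤ X.N g :=
  X.rearr_mono g h hg hh fun s _ => rearrE_mono_ae hgh s

lemma ae_ne_top_of_N_ne_top {g : ℝ → ℝ≥0∞} (hg : Measurable g) (hN : X.N g ≠ ∞) :
    ∀ᵐ x, g x ≠ ∞ := by
  have hA : MeasurableSet {x | g x = ∞} := hg (measurableSet_singleton ∞)
  set e : ℝ → ℝ≥0∞ := {x | g x = ∞}.indicator 1 with he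
  have hem : AEMeasurable e volume := (measurable_one.indicator hA).aemeasurable
  have hle : ∞ * X.N e ≤ X.N g := by
    rw [← X.norm_smul]
    refine X.N_mono_ae hg.aemeasurable (hem.const_mul _) (ae_of_all _ fun x => ?_)
    by_cases hx : g x = ∞ <;> simp [he, hx]
  have h0 : X.N e = 0 := by
    by_contra h0
    rw [ENNReal.top_mul h0] at hle
    exact hN (top_le_iff.1 hle)
  filter_upwards [(X.definite e hem).1 h0] with x hx hgx
  simp [he, hgx] at hx

lemma zero_lt_two_mul_C : 0 < 2 * X.C := by linarith [X.one_le_C]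

/-- Terms decaying faster than the powers of the quasi-triangle constant grow have uniformly
bounded finite sums. -/
lemma N_sum_range_le (m : ℕ) : ∀ (u : ℕ → ℝ → ℝ≥0∞) (M : ℝ≥0∞),
    (∀ n, AEMeasurable (u n) volume) →
    (∀ n, X.N (u n) ≤ M * (ENNReal.ofReal (2 * X.C))⁻¹ ^ n) →
    X.N (fun x => ∑ n ∈ Finset.range m, u n x) ≤ ENNReal.ofReal (2 * X.C) * M := by
  induction m with
  | zero =>
    intro u M _ _
    have h0 : X.N (fun _ => 0) = 0 := (X.definite _ aemeasurable_const).2 (ae_of_all _ fun _ => rfl)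
    simp [h0]
  | succ m ih =>
    intro u M hu hM
    have hD0 : ENNReal.ofReal (2 * X.C) ≠ 0 := by
      simpa using X.zero_lt_two_mul_C
    have hD : ENNReal.ofReal (2 * X.C) ≠ ∞ := ENNReal.ofReal_ne_top
    have h1 := ih (fun n => u (n + 1)) (M * (ENNReal.ofReal (2 * X.C))⁻¹) (fun n => hu _)
      (fun n => by simpa [pow_succ', mul_assoc] using hM (n + 1))
    have h2 : ENNReal.ofReal (2 * X.C) * (M * (ENNReal.ofReal (2 * X.C))⁻¹) = M := by
      rw [mul_left_comm, ENNReal.mul_inv_cancel hD0 hD, mul_one]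
    rw [h2] at h1
    have h3 : X.N (u 0) ≤ M := by simpa using hM 0
    have h4 : (fun x => ∑ n ∈ Finset.range (m + 1), u n x) =
        fun x => (∑ n ∈ Finset.range m, u (n + 1) x) + u 0 x := by
      ext x; rw [Finset.sum_range_succ']
    rw [h4]
    calc _ ≤ ENNReal.ofReal X.C * (_ + _) :=
          X.quasi_triangle _ _ (Finset.aemeasurable_fun_sum _ fun n _ => hu (n + 1)) (hu 0)
      _ ≤ ENNReal.ofReal X.C * (M + M) := by gcongr
      _ = _ := by
        rw [ENNReal.ofReal_mul zero_le_two, ENNReal.ofReal_ofNat]; ring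

/-- A Riesz–Fischer estimate: the quasi-norm of a sufficiently fast converging series of
nonnegative functions. -/
lemma N_tsum_le (v : ℕ → ℝ → ℝ) (hv : ∀ n, AEMeasurable (v n) volume) (hv0 : ∀ n x, 0 ≤ v n x)
    (M : ℝ≥0∞) (hMtop : M ≠ ∞)
    (hM : ∀ n, X.N (fun x => ENNReal.ofReal (v n x)) ≤ M * (ENNReal.ofReal (2 * X.C))⁻¹ ^ n) :
    X.N (fun x => ∑' n, ENNReal.ofReal (v n x)) ≤
      ENNReal.ofReal X.C * (ENNReal.ofReal (2 * X.C) * M) := by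
  set D : ℝ≥0∞ := ENNReal.ofReal (2 * X.C) with hDdef
  have hDtop : D ≠ ∞ := ENNReal.ofReal_ne_top
  have hD1 : 1 < D := by
    rw [hDdef, ← ENNReal.ofReal_one, ENNReal.ofReal_lt_ofReal_iff X.zero_lt_two_mul_C]
    linarith [X.one_le_C]
  have hvE : ∀ n, AEMeasurable (fun x => ENNReal.ofReal (v n x)) volume :=
    fun n => (hv n).ennreal_ofReal
  set F : ℕ → ℝ → ℝ := fun m x => ∑ n ∈ Finset.range m, v n x with hF
  have hFm : ∀ m, AEMeasurable (F m) volume :=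
    fun m => Finset.aemeasurable_fun_sum _ fun n _ => hv n
  have hF0 : ∀ m x, 0 ≤ F m x := fun m x => Finset.sum_nonneg fun n _ => hv0 n x
  have hFE : ∀ m x, ENNReal.ofReal (F m x) = ∑ n ∈ Finset.range m, ENNReal.ofReal (v n x) :=
    fun m x => ENNReal.ofReal_sum_of_nonneg fun n _ => hv0 n x
  have hFN : ∀ m, X.N (fun x => ENNReal.ofReal |F m x|) ≤ D * M := by
    intro m
    simp_rw [abs_of_nonneg (hF0 m _), hFE]
    exact X.N_sum_range_le m _ M hvE hM
  have hdiff : ∀ k j, X.N (fun x => ENNReal.ofReal |F (k + j) x - F k x|) ≤ D * (M * D⁻¹ ^ k) := by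
    intro k j
    have : (fun x => ENNReal.ofReal |F (k + j) x - F k x|) =
        fun x => ∑ n ∈ Finset.range j, ENNReal.ofReal (v (k + n) x) := by
      ext x
      rw [← ENNReal.ofReal_sum_of_nonneg fun n _ => hv0 _ x, hF]
      simp only [Finset.sum_range_add, add_sub_cancel_left]
      rw [abs_of_nonneg (Finset.sum_nonneg fun n _ => hv0 _ x)]
    rw [this]
    exact X.N_sum_range_le j _ _ (fun n => hvE _) fun n => by
      rw [mul_assoc, ← pow_add]
      exact hM (k + n)
  have htail : Tendsto (fun k : ℕ => D * (M * D⁻¹ ^ k)) atTop (𝓝 0) := by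
    have h1 := ENNReal.tendsto_pow_atTop_nhds_zero_of_lt_one (ENNReal.inv_lt_one.2 hD1)
    have h2 := ENNReal.Tendsto.const_mul h1 (Or.inr hMtop)
    have h3 := ENNReal.Tendsto.const_mul h2 (Or.inr hDtop)
    simpa using h3
  obtain ⟨g, hgm, -, hg⟩ := X.complete F
    (fun m => ⟨hFm m, (hFN m).trans_lt (ENNReal.mul_lt_top hDtop.lt_top hMtop.lt_top)⟩) (by
      intro ε hε
      obtain ⟨K, hK⟩ := eventually_atTop.1
        (htail.eventually (gt_mem_nhds (ENNReal.ofReal_pos.2 hε)))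
      refine ⟨K, fun m hm n hn => ?_⟩
      rcases le_total n m with h | h
      · obtain ⟨j, rfl⟩ := Nat.exists_eq_add_of_le h
        exact (hdiff n j).trans_lt (hK n hn)
      · obtain ⟨j, rfl⟩ := Nat.exists_eq_add_of_le h
        simp_rw [abs_sub_comm (F m _)]
        exact (hdiff m j).trans_lt (hK m hm))
  have hFmono : ∀ x, Monotone fun m => F m x := fun x m n hmn =>
    Finset.sum_le_sum_of_subset_of_nonneg (Finset.range_mono hmn) fun i _ _ => hv0 i x
  have habs : ∀ m, AEMeasurable (fun x => ENNReal.ofReal |F m x - g x|) volume := fun m =>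
    ((hFm m).sub hgm).abs.ennreal_ofReal
  have hle : ∀ n, ∀ᵐ x, F n x ≤ g x := by
    intro n
    have hm : AEMeasurable (fun x => ENNReal.ofReal (F n x - g x)) volume :=
      ((hFm n).sub hgm).ennreal_ofReal
    have h0 : X.N (fun x => ENNReal.ofReal (F n x - g x)) = 0 := by
      refine le_antisymm (ge_of_tendsto hg ?_) bot_le
      filter_upwards [eventually_ge_atTop n] with m hnm
      refine X.N_mono_ae (habs m) hm (ae_of_all _ fun x => ENNReal.ofReal_le_ofReal ?_)
      exact (sub_le_sub_right (hFmono x hnm) _).trans (le_abs_self _)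
    filter_upwards [(X.definite _ hm).1 h0] with x hx
    simpa using hx
  have hgabs : AEMeasurable (fun x => ENNReal.ofReal |g x|) volume := hgm.abs.ennreal_ofReal
  have h1 : X.N (fun x => ∑' n, ENNReal.ofReal (v n x)) ≤ X.N (fun x => ENNReal.ofReal |g x|) := by
    refine X.N_mono_ae hgabs (AEMeasurable.tsum hvE) ?_
    filter_upwards [ae_all_iff.2 hle] with x hx
    refine ENNReal.tsum_le_of_sum_range_le fun n => ?_
    rw [← hFE]
    exact ENNReal.ofReal_le_ofReal ((hx n).trans (le_abs_self _))
  have h2 : ∀ n, X.N (fun x => ENNReal.ofReal |g x|) ≤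
      ENNReal.ofReal X.C * (D * M + X.N fun x => ENNReal.ofReal |F n x - g x|) := by
    intro n
    have hFa : AEMeasurable (fun x => ENNReal.ofReal |F n x|) volume := (hFm n).abs.ennreal_ofReal
    refine (X.N_mono_ae (hFa.add (habs n)) hgabs (ae_of_all _ fun x => ?_)).trans
      ((X.quasi_triangle _ _ hFa (habs n)).trans (by gcongr; exact hFN n))
    simp only [Pi.add_apply]
    rw [← ENNReal.ofReal_add (abs_nonneg _) (abs_nonneg _)]
    refine ENNReal.ofReal_le_ofReal ?_
    have := abs_sub (F n x) (F n x - g x)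
    simpa using this
  have h3 := ENNReal.Tendsto.const_mul (a := ENNReal.ofReal X.C) (hg.const_add (D * M))
    (Or.inr ENNReal.ofReal_ne_top)
  rw [add_zero] at h3
  exact h1.trans (ge_of_tendsto' h3 h2)

end RIQB

lemma lintegral_Ioo_rpow_sub_one {b t : ℝ} (hb : 0 < b) (ht : 0 < t) :
    ∫⁻ s in Ioo (0 : ℝ) t, ENNReal.ofReal (s ^ (b - 1)) = ENNReal.ofReal (t ^ b / b) := by
  have hi : IntervalIntegrable (fun s : ℝ => s ^ (b - 1)) volume 0 t :=
    intervalIntegral.intervalIntegrable_rpow' (by linarith)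
  rw [← ofReal_integral_eq_lintegral_ofReal]
  · rw [← integral_Ioc_eq_integral_Ioo, ← intervalIntegral.integral_of_le ht.le,
      integral_rpow (Or.inl (by linarith))]
    simp [Real.zero_rpow hb.ne']
  · exact ((intervalIntegrable_iff_integrableOn_Ioc_of_le ht.le).1 hi).mono_set Ioo_subset_Ioc_self
  · filter_upwards [ae_restrict_mem measurableSet_Ioo] with s hs
    exact Real.rpow_nonneg hs.1.le _

/-- A pointwise power bound on `g` over `(0, t)` bounds the Hardy operator at `t`. -/
lemma hardyUE_le_of_le_rpow {p r a t : ℝ} (hp : 0 < p) (hr : 0 < r) (hap : a < 1 / p) (ht : 0 < t)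
    {g : ℝ → ℝ≥0∞} {S : ℝ≥0∞} (hg : ∀ s ∈ Ioo 0 t, g s ≤ ENNReal.ofReal ((t / s) ^ a) * S) :
    hardyUE p r g t ≤ ENNReal.ofReal ((r / p / (r / p - a * r)) ^ (1 / r)) * S := by
  have hb : 0 < r / p - a * r := by
    have := mul_lt_mul_of_pos_right hap hr
    have h2 : 1 / p * r = r / p := by ring
    linarith
  set b := r / p - a * r with hbdef
  have hrp : 0 < r / p := div_pos hr hp
  have hint : ∫⁻ s in Ioo (0 : ℝ) t, g s ^ r * ENNReal.ofReal (s ^ (r / p - 1)) ≤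
      S ^ r * ENNReal.ofReal (t ^ (r / p) / b) := by
    calc _ ≤ ∫⁻ s in Ioo (0 : ℝ) t,
          S ^ r * ENNReal.ofReal (t ^ (a * r)) * ENNReal.ofReal (s ^ (b - 1)) := by
          refine setLIntegral_mono' measurableSet_Ioo fun s hs => ?_
          calc _ ≤ (ENNReal.ofReal ((t / s) ^ a) * S) ^ r * ENNReal.ofReal (s ^ (r / p - 1)) := by
                gcongr; exact hg s hs
            _ = S ^ r * ENNReal.ofReal (((t / s) ^ a) ^ r * s ^ (r / p - 1)) := by
                have h0 : 0 ≤ (t / s) ^ a := Real.rpow_nonneg (div_pos ht hs.1).le _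
                rw [ENNReal.mul_rpow_of_nonneg _ _ hr.le, ENNReal.ofReal_rpow_of_nonneg h0 hr.le,
                  ENNReal.ofReal_mul (Real.rpow_nonneg h0 _)]
                ring
            _ = _ := by
                rw [mul_assoc, ← ENNReal.ofReal_mul (Real.rpow_nonneg ht.le _)]
                congr 2
                rw [← Real.rpow_mul (div_pos ht hs.1).le, Real.div_rpow ht.le hs.1.le,
                  div_mul_eq_mul_div, mul_div_assoc, ← Real.rpow_sub hs.1]
                congr 2
                rw [hbdef]; ring
      _ = _ := by
          rw [lintegral_const_mul _ (by fun_prop), lintegral_Ioo_rpow_sub_one hb ht, mul_assoc,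
            ← ENNReal.ofReal_mul (Real.rpow_nonneg ht.le _), ← mul_div_assoc, ← Real.rpow_add ht]
          congr 4
          rw [hbdef]; ring
  rw [hardyUE, if_pos ht]
  calc _ ≤ ENNReal.ofReal t ^ (-(1 / p)) *
        (ENNReal.ofReal (r / p) * (S ^ r * ENNReal.ofReal (t ^ (r / p) / b))) ^ (1 / r) := by
        gcongr
    _ = ENNReal.ofReal (t ^ (-(1 / p))) *
        (S ^ r * ENNReal.ofReal (r / p / b * t ^ (r / p))) ^ (1 / r) := by
        rw [ENNReal.ofReal_rpow_of_pos ht, mul_left_comm, ← ENNReal.ofReal_mul hrp.le]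
        congr 4
        ring
    _ = ENNReal.ofReal (t ^ (-(1 / p))) *
        (ENNReal.ofReal ((r / p / b * t ^ (r / p)) ^ (1 / r)) * S) := by
        have h0 : 0 ≤ r / p / b * t ^ (r / p) := by positivity
        rw [ENNReal.mul_rpow_of_nonneg _ _ (by positivity), ← ENNReal.rpow_mul,
          mul_one_div_cancel hr.ne', ENNReal.rpow_one, mul_comm S,
          ENNReal.ofReal_rpow_of_nonneg h0 (by positivity)]
    _ = _ := by
        rw [← mul_assoc, ← ENNReal.ofReal_mul (by positivity)]
        congr 2
        rw [Real.mul_rpow (by positivity) (by positivity), ← Real.rpow_mul ht.le, mul_left_comm,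
          ← Real.rpow_add ht]
        have : -(1 / p) + r / p * (1 / r) = 0 := by field_simp; ring
        rw [this, Real.rpow_zero, mul_one]

/-- An antitone function at scale `s < t` is controlled by a series of its dilates at `t`. -/
lemma antitone_le_rpow_mul_tsum {g : ℝ → ℝ≥0∞} (hg : Antitone g) {a B s t : ℝ} (ha : 0 < a)
    (hB : 1 < B) (hs : 0 < s) (hst : s < t) :
    g s ≤ ENNReal.ofReal ((t / s) ^ a) *
      ∑' n : ℕ, ENNReal.ofReal ((B ^ n) ^ (-a)) * g ((B ^ (n + 1))⁻¹ * t) := by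
  have hB0 : 0 < B := by linarith
  obtain ⟨n, hn1, hn2⟩ := exists_nat_pow_near ((one_le_div hs).2 hst.le) hB
  have hBn : 0 < B ^ n := pow_pos hB0 n
  calc g s ≤ g ((B ^ (n + 1))⁻¹ * t) := by
        refine hg ?_
        rw [inv_mul_le_iff₀ (pow_pos hB0 _)]
        exact ((div_lt_iff₀ hs).1 hn2).le
    _ = ENNReal.ofReal ((B ^ n) ^ a) *
        (ENNReal.ofReal ((B ^ n) ^ (-a)) * g ((B ^ (n + 1))⁻¹ * t)) := by
        rw [← mul_assoc, ← ENNReal.ofReal_mul (by positivity), ← Real.rpow_add hBn]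
        simp
    _ ≤ _ := by
        gcongr
        exact ENNReal.le_tsum (f := fun n : ℕ =>
          ENNReal.ofReal ((B ^ n) ^ (-a)) * g ((B ^ (n + 1))⁻¹ * t)) n

lemma measurable_hardyUE (p r : ℝ) (g : ℝ → ℝ≥0∞) : Measurable (hardyUE p r g) := by
  refine Measurable.ite measurableSet_Ioi ?_ measurable_const
  have hmono : Monotone fun t : ℝ =>
      ∫⁻ s in Ioo (0 : ℝ) t, g s ^ r * ENNReal.ofReal (s ^ (r / p - 1)) :=
    fun a b hab => lintegral_mono_set (Ioo_subset_Ioo_right hab)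
  have := hmono.measurable
  fun_prop

lemma RIQB.rearr_ne_top (X : RIQB) {f : ℝ → ℝ} (hf : X.mem f) {s : ℝ} (hs : 0 < s) :
    rearr f s ≠ ∞ := by
  have hanti : Antitone (rearr f) := antitone_rearrE _
  have hm : Measurable ((Ioi 0).indicator (rearr f)) := hanti.measurable.indicator measurableSet_Ioi
  have hN : X.N ((Ioi 0).indicator (rearr f)) ≤ X.Nr f :=
    X.rearr_mono _ _ hf.1.abs.ennreal_ofReal hm.aemeasurable
      fun s _ => rearrE_indicator_le hanti s
  intro htop
  have hae := X.ae_ne_top_of_N_ne_top hm (hN.trans_lt hf.2).ne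
  have hsub : Ioo 0 s ⊆ {x | ¬ (Ioi 0).indicator (rearr f) x ≠ ∞} := by
    intro x hx
    simp only [mem_ofPred_eq, not_not]
    rw [indicator_of_mem (show x ∈ Ioi (0 : ℝ) from hx.1)]
    exact top_le_iff.1 (htop ▸ hanti hx.2.le)
  have h0 := measure_mono_null hsub (ae_iff.1 hae)
  simp only [Real.volume_Ioo, sub_zero, ENNReal.ofReal_eq_zero] at h0
  linarith

/-- **Theorem 2 (i), sufficiency.** If `p_X > p` then `H^{(p,r)}` is bounded on `X`. -/
theorem hardyU_bounded_of_lt_lowerBoyd (X : RIQB) (p r : ℝ) (hp : 0 < p) (hr : 0 < r)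
    (hpX : ENNReal.ofReal p < lowerBoyd X) :
    ∃ c : ℝ, 0 < c ∧ ∀ f : ℝ → ℝ, X.mem f →
      X.N (hardyU p r f) ≤ ENNReal.ofReal c * X.Nr f := by
  obtain ⟨q, ⟨hq, c, hc, hdil⟩, hpq⟩ : ∃ q ∈ {q : ℝ | 0 < q ∧ ∃ c : ℝ, 0 < c ∧
      ∀ a : ℝ, 0 < a → a < 1 → ∀ f : ℝ → ℝ, AEMeasurable f volume → X.Nr f < ∞ →
        X.Nr (dil a f) ≤ ENNReal.ofReal (c * a ^ (-(1/q))) * X.Nr f},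
      ENNReal.ofReal p < ENNReal.ofReal q := by
    simpa only [lowerBoyd, lowerBoydOf, lt_iSup_iff, exists_prop] using hpX
  have hpq' : p < q := (ENNReal.ofReal_lt_ofReal_iff hq).1 hpq
  have hqp : 1 / q < 1 / p := one_div_lt_one_div_of_lt hp hpq'
  obtain ⟨a, hqa, hap⟩ := exists_between hqp
  have ha : 0 < a := (one_div_pos.2 hq).trans hqa
  have hd : 0 < a - 1 / q := sub_pos.2 hqa
  have hC : 1 < 2 * X.C := by linarith [X.one_le_C]
  have hC0 := X.zero_lt_two_mul_C
  set B : ℝ := (2 * X.C) ^ (1 / (a - 1 / q)) with hBdef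
  have hB : 1 < B := Real.one_lt_rpow hC (one_div_pos.2 hd)
  have hB0 : 0 < B := by linarith
  have hBC : B ^ (1 / q - a) = (2 * X.C)⁻¹ := by
    rw [hBdef, ← Real.rpow_mul hC0.le, ← Real.rpow_neg_one]
    congr 1
    rw [one_div_mul_eq_div, ← neg_sub, neg_div, div_self hd.ne']
  have hb : 0 < r / p - a * r := by
    have := mul_lt_mul_of_pos_right hap hr
    have h2 : 1 / p * r = r / p := by ring
    linarith
  set K : ℝ := (r / p / (r / p - a * r)) ^ (1 / r) with hK
  have hK0 : 0 < K := by positivity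
  have hX1 : 0 < X.C := by linarith
  refine ⟨K * (X.C * (2 * X.C * (c * B ^ (1 / q)))), by positivity, fun f hf => ?_⟩
  have hanti : Antitone (rearr f) := antitone_rearrE _
  set G : ℝ → ℝ := (Ioi 0).indicator fun s => (rearr f s).toReal with hG
  have hGm : Measurable G := hanti.measurable.ennreal_toReal.indicator measurableSet_Ioi
  have hG0 : ∀ s, 0 ≤ G s := fun s => indicator_nonneg (fun _ _ => ENNReal.toReal_nonneg) s
  have hGE : ∀ s, ENNReal.ofReal (G s) = (Ioi 0).indicator (rearr f) s := by
    intro s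
    by_cases hs : s ∈ Ioi (0 : ℝ)
    · rw [hG, indicator_of_mem hs, indicator_of_mem hs, ENNReal.ofReal_toReal (X.rearr_ne_top hf hs)]
    · simp [hG, indicator_of_notMem hs]
  have hGN : X.Nr G ≤ X.Nr f := by
    unfold RIQB.Nr
    simp_rw [abs_of_nonneg (hG0 _), hGE]
    exact X.rearr_mono _ _ hf.1.abs.ennreal_ofReal
      (hanti.measurable.indicator measurableSet_Ioi).aemeasurable
      fun s _ => rearrE_indicator_le hanti s
  set v : ℕ → ℝ → ℝ := fun n t => (B ^ n) ^ (-a) * dil (B ^ (n + 1))⁻¹ G t with hv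
  have hv0 : ∀ n t, 0 ≤ v n t := fun n t => mul_nonneg (by positivity) (hG0 _)
  have hvm : ∀ n, Measurable (v n) := fun n =>
    (hGm.comp (measurable_const_mul _)).const_mul _
  set M : ℝ≥0∞ := ENNReal.ofReal (c * B ^ (1 / q)) * X.Nr f with hM
  have hvN : ∀ n, X.N (fun x => ENNReal.ofReal (v n x)) ≤
      M * (ENNReal.ofReal (2 * X.C))⁻¹ ^ n := by
    intro n
    have h1 : (fun x => ENNReal.ofReal (v n x)) = fun x =>
        ENNReal.ofReal ((B ^ n) ^ (-a)) * ENNReal.ofReal |dil (B ^ (n + 1))⁻¹ G x| := by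
      ext x
      rw [← ENNReal.ofReal_mul (by positivity),
        abs_of_nonneg (show 0 ≤ dil (B ^ (n + 1))⁻¹ G x from hG0 _)]
    have hpow : (B ^ n) ^ (-a) * (c * ((B ^ (n + 1))⁻¹) ^ (-(1 / q))) =
        c * B ^ (1 / q) * (2 * X.C)⁻¹ ^ n := by
      rw [Real.inv_rpow (by positivity), Real.rpow_neg (by positivity) (1 / q), inv_inv, pow_succ,
        Real.mul_rpow (by positivity) hB0.le, ← hBC, ← Real.rpow_natCast (B ^ (1 / q - a)),
        ← Real.rpow_mul hB0.le, mul_comm (1 / q - a), Real.rpow_mul hB0.le, Real.rpow_natCast,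
        sub_eq_add_neg, Real.rpow_add (by positivity)]
      ring
    rw [h1, X.norm_smul]
    calc _ ≤ ENNReal.ofReal ((B ^ n) ^ (-a)) *
          (ENNReal.ofReal (c * ((B ^ (n + 1))⁻¹) ^ (-(1 / q))) * X.Nr f) := by
          gcongr
          exact (hdil _ (by positivity) (inv_lt_one_of_one_lt₀ (one_lt_pow₀ hB (by simp))) G
            hGm.aemeasurable (hGN.trans_lt hf.2)).trans (by gcongr)
      _ = _ := by
          rw [← mul_assoc, ← ENNReal.ofReal_mul (by positivity), hpow,
            ENNReal.ofReal_mul (by positivity), ENNReal.ofReal_pow (by positivity),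
            ENNReal.ofReal_inv_of_pos hC0, hM]
          ring
  have hS := X.N_tsum_le v (fun n => (hvm n).aemeasurable) hv0 M
    (ENNReal.mul_ne_top ENNReal.ofReal_ne_top hf.2.ne) hvN
  have hpt : ∀ t, hardyU p r f t ≤ ENNReal.ofReal K * ∑' n, ENNReal.ofReal (v n t) := by
    intro t
    by_cases ht : 0 < t
    · refine hardyUE_le_of_le_rpow hp hr hap ht fun s hs => ?_
      refine (antitone_le_rpow_mul_tsum hanti ha hB hs.1 hs.2).trans_eq ?_
      congr 2
      ext n
      rw [hv, ENNReal.ofReal_mul (by positivity), dil, hGE,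
        indicator_of_mem (show _ ∈ Ioi (0 : ℝ) from mul_pos (by positivity) ht)]
    · simp [hardyU, hardyUE, ht]
  have hSm : AEMeasurable (fun t => ∑' n, ENNReal.ofReal (v n t)) volume :=
    AEMeasurable.tsum fun n => (hvm n).aemeasurable.ennreal_ofReal
  calc X.N (hardyU p r f) ≤ X.N fun t => ENNReal.ofReal K * ∑' n, ENNReal.ofReal (v n t) :=
        X.N_mono_ae (hSm.const_mul _) (measurable_hardyUE p r _).aemeasurable (ae_of_all _ hpt)
    _ ≤ ENNReal.ofReal K * (ENNReal.ofReal X.C * (ENNReal.ofReal (2 * X.C) * M)) := by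
        rw [X.norm_smul]; gcongr
    _ = _ := by
        rw [hM, ENNReal.ofReal_mul hK0.le, ENNReal.ofReal_mul hX1.le, ENNReal.ofReal_mul hC0.le]
        ring

end
end

section
/- Let X be a rearrangement invariant quasi-Banach space on ℝ, let 0 < p < ∞ and 0 < r < ∞, and suppose there is a constant C > 1 such that ‖H^{(p,r)} f‖_X ≤ C ‖f‖_X for all f ∈ X. Then the lower Boyd index of X satisfies p_X ≥ p/(1 − C^{−r}); in particular p_X > p. -/
open MeasureTheory Set Filter Topology ENNReal

noncomputable section

section Rearrangement

variable {α : Type*} [MeasurableSpace α] {μ : Measure α}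

lemma distRearr_antitone (g : α → ℝ≥0∞) : Antitone (distRearr μ g) := fun _ _ hst =>
  sSup_le_sSup fun _ hu => (ENNReal.ofReal_le_ofReal hst).trans_lt hu

lemma distRearr_mono {g h : α → ℝ≥0∞} (hgh : ∀ x, g x ≤ h x) (s : ℝ) :
    distRearr μ g s ≤ distRearr μ h s :=
  sSup_le_sSup fun _ hu => lt_of_lt_of_le hu (measure_mono fun x hx => lt_of_lt_of_le hx (hgh x))

lemma mul_distRearr_le {k : ℝ≥0∞} (hk₀ : k ≠ 0) (hk : k ≠ ∞) (g : α → ℝ≥0∞) (s : ℝ) :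
    k * distRearr μ g s ≤ distRearr μ (fun x => k * g x) s := by
  rw [distRearr, ENNReal.mul_sSup]
  refine iSup₂_le fun t ht => le_sSup ?_
  simpa only [mem_ofPred_eq, ENNReal.mul_lt_mul_iff_right hk₀ hk] using ht

lemma le_rearrE_of_antitoneOn {h : ℝ → ℝ≥0∞} (hh : AntitoneOn h (Ioi 0)) {s t : ℝ}
    (hs : 0 < s) (hst : s < t) : h t ≤ rearrE h s := by
  refine le_of_forall_lt fun u hu => ?_
  obtain ⟨v, huv, hv⟩ := exists_between hu
  refine huv.trans_le (le_sSup ?_)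
  have hsub : Ioo 0 t ⊆ {x | v < h x} := fun x hx =>
    hv.trans_le (hh hx.1 (hs.trans hst) hx.2.le)
  calc ENNReal.ofReal s < ENNReal.ofReal t := (ENNReal.ofReal_lt_ofReal_iff (hs.trans hst)).2 hst
    _ = volume (Ioo 0 t) := by simp
    _ ≤ _ := measure_mono hsub

lemma rearr_dil (f : ℝ → ℝ) {a : ℝ} (ha : 0 < a) (s : ℝ) : rearr (dil a f) s = rearr f (a * s) := by
  unfold rearr rearrE distRearr
  congr 1
  ext t
  have hvol : volume {x | t < ENNReal.ofReal |dil a f x|} =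
      ENNReal.ofReal a⁻¹ * volume {x | t < ENNReal.ofReal |f x|} := by
    have := Real.volume_preimage_mul_left ha.ne' {x | t < ENNReal.ofReal |f x|}
    rwa [abs_of_pos (inv_pos.2 ha)] at this
  have h0 : ENNReal.ofReal a⁻¹ ≠ 0 := by simpa using ha
  have hs : ENNReal.ofReal s = ENNReal.ofReal a⁻¹ * ENNReal.ofReal (a * s) := by
    rw [← ENNReal.ofReal_mul (inv_pos.2 ha).le, inv_mul_cancel_left₀ ha.ne']
  simp only [mem_ofPred_eq]
  rw [hvol, hs, ENNReal.mul_lt_mul_iff_right h0 ENNReal.ofReal_ne_top]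

end Rearrangement

section Hardy

variable {p r : ℝ} {g : ℝ → ℝ≥0∞}

lemma hardyUE_rpow (hr : 0 < r) (hp : 0 < p) (g : ℝ → ℝ≥0∞) {t : ℝ} (ht : 0 < t) :
    hardyUE p r g t ^ r = ENNReal.ofReal (r / p * t ^ (-(r / p))) *
      ∫⁻ s in Ioo (0:ℝ) t, g s ^ r * ENNReal.ofReal (s ^ (r/p - 1)) := by
  have he : -(1 / p) * r = -(r / p) := by ring
  rw [hardyUE, if_pos ht, ENNReal.mul_rpow_of_nonneg _ _ hr.le, ← ENNReal.rpow_mul,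
    ← ENNReal.rpow_mul, one_div_mul_cancel hr.ne', ENNReal.rpow_one, he,
    ENNReal.ofReal_rpow_of_pos ht, ENNReal.ofReal_mul (by positivity), ← mul_assoc,
    mul_comm (ENNReal.ofReal (r / p))]

lemma lintegral_Ioo_mul_left (φ : ℝ → ℝ≥0∞) {l : ℝ} (hl : 0 < l) (t : ℝ) :
    ∫⁻ s in Ioo 0 (l * t), φ s = ENNReal.ofReal l * ∫⁻ s in Ioo 0 t, φ (l * s) := by
  have himg : (fun s => l * s) '' Ioo 0 t = Ioo 0 (l * t) := by
    rw [image_mul_left_Ioo hl, mul_zero]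
  rw [← himg, lintegral_image_eq_lintegral_abs_deriv_mul (f' := fun _ => l) measurableSet_Ioo
    (fun x _ => by simpa using ((hasDerivAt_id x).const_mul l).hasDerivWithinAt)
    (mul_right_injective₀ hl.ne').injOn, abs_of_pos hl,
    lintegral_const_mul' _ _ ENNReal.ofReal_ne_top]

lemma hardyUE_antitoneOn (hr : 0 < r) (hp : 0 < p) (hg : Antitone g) :
    AntitoneOn (hardyUE p r g) (Ioi 0) := by
  intro t (ht : 0 < t) t' (ht' : 0 < t') htt
  obtain ⟨l, rfl⟩ : ∃ l, t' = l * t := ⟨t' / t, by field_simp⟩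
  have hl1 : 1 ≤ l := by
    by_contra! h
    nlinarith
  have hl : 0 < l := by linarith
  rw [← ENNReal.rpow_le_rpow_iff hr, hardyUE_rpow hr hp g ht, hardyUE_rpow hr hp g ht',
    lintegral_Ioo_mul_left _ hl]
  have hle : ∫⁻ s in Ioo 0 t, g (l * s) ^ r * ENNReal.ofReal ((l * s) ^ (r/p - 1)) ≤
      ENNReal.ofReal (l ^ (r/p - 1)) *
        ∫⁻ s in Ioo 0 t, g s ^ r * ENNReal.ofReal (s ^ (r/p - 1)) := by
    rw [← lintegral_const_mul' _ _ ENNReal.ofReal_ne_top]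
    refine setLIntegral_mono' measurableSet_Ioo fun s hs => ?_
    rw [Real.mul_rpow hl.le hs.1.le, ENNReal.ofReal_mul (by positivity), mul_left_comm]
    gcongr
    exact hg (le_mul_of_one_le_left hs.1.le hl1)
  refine (mul_le_mul_right (mul_le_mul_right hle _) _).trans_eq ?_
  rw [← mul_assoc, ← mul_assoc, ← ENNReal.ofReal_mul (by positivity),
    ← ENNReal.ofReal_mul (by positivity)]
  congr 2
  rw [Real.mul_rpow hl.le ht.le, Real.rpow_sub_one hl.ne', Real.rpow_neg hl.le]
  have := (Real.rpow_pos_of_pos hl (r / p)).ne'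
  field_simp

lemma hardyUE_le_rearrE (hr : 0 < r) (hp : 0 < p) (hg : Antitone g) {s : ℝ} (hs : 0 < s) :
    hardyUE p r g s ≤ rearrE (hardyUE p r g) s := by
  rw [← ENNReal.rpow_le_rpow_iff hr]
  refine ENNReal.le_of_forall_lt_one_mul_le fun a ha => ?_
  rcases eq_or_ne a 0 with rfl | ha0
  · simp
  have hκ : 0 < r / p := by positivity
  lift a to NNReal using (ha.trans one_lt_top).ne
  have ha1 : (a : ℝ) < 1 := by exact_mod_cast ha
  have hapos : 0 < (a : ℝ) := by
    rcases a.2.eq_or_lt with h | h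
    · exact absurd (by ext; exact h.symm) (ENNReal.coe_ne_zero.1 ha0)
    · exact h
  set l : ℝ := (a : ℝ) ^ (-(r / p)⁻¹) with hl
  have hl0 : 0 < l := Real.rpow_pos_of_pos hapos _
  have hl1 : 1 < l := Real.one_lt_rpow_of_pos_of_lt_one_of_neg hapos ha1 (neg_lt_zero.2 (inv_pos.2 hκ))
  have hlκ : l ^ (-(r / p)) = a := by
    rw [hl, ← Real.rpow_mul hapos.le, neg_mul_neg, inv_mul_cancel₀ hκ.ne', Real.rpow_one]
  have hst : s < l * s := lt_mul_of_one_lt_left hs hl1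
  refine le_trans ?_ (ENNReal.rpow_le_rpow
    (le_rearrE_of_antitoneOn (hardyUE_antitoneOn hr hp hg) hs hst) hr.le)
  rw [hardyUE_rpow hr hp g hs, hardyUE_rpow hr hp g (hs.trans hst), Real.mul_rpow hl0.le hs.le,
    hlκ, ← ENNReal.ofReal_coe_nnreal, ← mul_assoc, ← ENNReal.ofReal_mul hapos.le, mul_left_comm]
  gcongr

lemma hardyUE_measurable (hr : 0 < r) (hp : 0 < p) (hg : Antitone g) :
    AEMeasurable (hardyUE p r g) volume := by
  have h : hardyUE p r g = (Ioi 0).indicator (hardyUE p r g) := by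
    ext t
    by_cases ht : 0 < t
    · simp [ht]
    · simp [ht, hardyUE]
  rw [h, aemeasurable_indicator_iff measurableSet_Ioi]
  exact aemeasurable_restrict_of_antitoneOn measurableSet_Ioi (hardyUE_antitoneOn hr hp hg)

lemma le_hardyUE_rpow (hr : 0 < r) (hp : 0 < p) (hg : Antitone g) {y t : ℝ} (hy : 0 < y)
    (hyt : y < t) :
    g y ^ r * ENNReal.ofReal ((y / t) ^ (r / p)) ≤ hardyUE p r g t ^ r := by
  have ht : 0 < t := hy.trans hyt
  have hκ : 0 < r / p := by positivity
  have hint : ∫⁻ s in Ioo 0 y, ENNReal.ofReal (s ^ (r/p - 1)) =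
      ENNReal.ofReal (y ^ (r / p) / (r / p)) := by
    have hi : IntervalIntegrable (fun s : ℝ => s ^ (r/p - 1)) volume 0 y :=
      intervalIntegral.intervalIntegrable_rpow' (by linarith)
    rw [intervalIntegrable_iff_integrableOn_Ioo_of_le hy.le] at hi
    rw [← ofReal_integral_eq_lintegral_ofReal hi
      ((ae_restrict_iff' measurableSet_Ioo).2 (ae_of_all _ fun s hs => Real.rpow_nonneg hs.1.le _)),
      ← integral_Ioc_eq_integral_Ioo, ← intervalIntegral.integral_of_le hy.le,
      integral_rpow (Or.inl (by linarith)), sub_add_cancel, Real.zero_rpow hκ.ne', sub_zero]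
  rw [hardyUE_rpow hr hp g ht]
  calc g y ^ r * ENNReal.ofReal ((y / t) ^ (r / p))
      = ENNReal.ofReal (r / p * t ^ (-(r / p))) *
          (g y ^ r * ∫⁻ s in Ioo 0 y, ENNReal.ofReal (s ^ (r/p - 1))) := by
        rw [hint, mul_left_comm, ← ENNReal.ofReal_mul (by positivity)]
        congr 2
        rw [Real.div_rpow hy.le ht.le, Real.rpow_neg ht.le]
        field_simp
    _ = ENNReal.ofReal (r / p * t ^ (-(r / p))) *
          ∫⁻ s in Ioo 0 y, g y ^ r * ENNReal.ofReal (s ^ (r/p - 1)) := by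
        rw [lintegral_const_mul _ (by fun_prop)]
    _ ≤ ENNReal.ofReal (r / p * t ^ (-(r / p))) *
          ∫⁻ s in Ioo 0 y, g s ^ r * ENNReal.ofReal (s ^ (r/p - 1)) := by
        gcongr _ * ?_
        refine setLIntegral_mono' measurableSet_Ioo fun s hs => ?_
        gcongr
        exact hg hs.2.le
    _ ≤ _ := by
        gcongr _ * ?_
        exact lintegral_mono_set (Ioo_subset_Ioo_right hyt.le)

lemma le_hardyUE_rpow_succ (hr : 0 < r) (hp : 0 < p) {y t : ℝ} (hy : 0 < y) (hyt : y < t)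
    (n : ℕ) (A : ℝ≥0∞)
    (hg : ∀ s, y < s → A * ENNReal.ofReal
      ((y / s) ^ (r / p) * ((r / p * Real.log (s / y)) ^ n / n.factorial)) ≤ g s ^ r) :
    A * ENNReal.ofReal ((y / t) ^ (r / p) *
      ((r / p * Real.log (t / y)) ^ (n + 1) / (n + 1).factorial)) ≤ hardyUE p r g t ^ r := by
  have ht : 0 < t := hy.trans hyt
  have hκ : 0 < r / p := by positivity
  set κ := r / p with hκdef
  set φ : ℝ → ℝ := fun s => y ^ κ * (κ * Real.log (s / y)) ^ n / n.factorial * s⁻¹ with hφ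
  have hlog : ∀ s ∈ Ioo y t, 0 ≤ Real.log (s / y) := fun s hs =>
    Real.log_nonneg ((one_le_div hy).2 hs.1.le)
  have hint : ∫⁻ s in Ioo y t, ENNReal.ofReal (φ s) =
      ENNReal.ofReal (y ^ κ * (κ * Real.log (t / y)) ^ (n + 1) / (n + 1).factorial / κ) := by
    have hne : ∀ s ∈ uIcc y t, s ≠ 0 := fun s hs => by
      rw [uIcc_of_le hyt.le] at hs
      exact (hy.trans_le hs.1).ne'
    have hi : IntervalIntegrable φ volume y t := by
      refine ContinuousOn.intervalIntegrable ?_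
      have hlogc : ContinuousOn (fun s => Real.log (s / y)) (uIcc y t) :=
        ContinuousOn.log (by fun_prop) fun s hs => div_ne_zero (hne s hs) hy.ne'
      have hinv : ContinuousOn (fun s : ℝ => s⁻¹) (uIcc y t) := continuousOn_inv₀.mono hne
      fun_prop
    have hderiv : ∀ s ∈ uIcc y t, HasDerivAt
        (fun s => y ^ κ * (κ * Real.log (s / y)) ^ (n + 1) / (n + 1).factorial / κ) (φ s) s := by
      intro s hs
      have h1 : HasDerivAt (fun s => Real.log (s / y)) (s⁻¹) s := by
        have := ((hasDerivAt_id s).div_const y).log (div_ne_zero (hne s hs) hy.ne')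
        refine this.congr_deriv ?_
        have := hne s hs
        simp only [id]
        field_simp
      have h2 := ((((h1.const_mul κ).fun_pow (n + 1)).const_mul (y ^ κ)).div_const
        ((n + 1).factorial : ℝ)).div_const κ
      refine h2.congr_deriv ?_
      simp only [hφ, Nat.factorial_succ, add_tsub_cancel_right]
      push_cast
      have := hne s hs
      have : (n.factorial : ℝ) ≠ 0 := by positivity
      have : (n : ℝ) + 1 ≠ 0 := by positivity
      field_simp
    have hi' := hi
    rw [intervalIntegrable_iff_integrableOn_Ioo_of_le hyt.le] at hi'
    rw [← ofReal_integral_eq_lintegral_ofReal hi'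
      ((ae_restrict_iff' measurableSet_Ioo).2 (ae_of_all _ fun s hs => by
        have := hlog s hs
        have := hy.trans hs.1
        simp only [hφ, Pi.zero_apply]
        positivity)),
      ← integral_Ioc_eq_integral_Ioo, ← intervalIntegral.integral_of_le hyt.le,
      intervalIntegral.integral_eq_sub_of_hasDerivAt hderiv hi]
    simp [hy.ne']
  have hφm : Measurable φ := by
    simp only [hφ]
    fun_prop
  rw [hardyUE_rpow hr hp g ht, ← hκdef]
  calc _ = ENNReal.ofReal (κ * t ^ (-κ)) * (A * ∫⁻ s in Ioo y t, ENNReal.ofReal (φ s)) := by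
        rw [hint, mul_left_comm, ← ENNReal.ofReal_mul (by positivity)]
        congr 2
        rw [Real.div_rpow hy.le ht.le, Real.rpow_neg ht.le]
        field_simp
    _ = ENNReal.ofReal (κ * t ^ (-κ)) * ∫⁻ s in Ioo y t, A * ENNReal.ofReal (φ s) := by
        rw [lintegral_const_mul _ (by fun_prop)]
    _ ≤ ENNReal.ofReal (κ * t ^ (-κ)) *
          ∫⁻ s in Ioo y t, g s ^ r * ENNReal.ofReal (s ^ (κ - 1)) := by
        gcongr _ * ?_
        refine setLIntegral_mono' measurableSet_Ioo fun s hs => ?_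
        have hs0 : 0 < s := hy.trans hs.1
        refine le_trans (le_of_eq ?_) (mul_le_mul_left (hg s hs.1) _)
        have := hlog s hs
        rw [mul_assoc, ← ENNReal.ofReal_mul (by positivity), Real.div_rpow hy.le hs0.le,
          Real.rpow_sub_one hs0.ne']
        congr 2
        have := (Real.rpow_pos_of_pos hs0 κ).ne'
        simp only [hφ]
        field_simp
    _ ≤ _ := by
        gcongr _ * ?_
        exact lintegral_mono_set (Ioo_subset_Ioo_left hy.le)

end Hardy

section Boyd

lemma exists_exp_le_pow_div_factorial {x θ : ℝ} (hθ₀ : 0 ≤ θ) (hθ₁ : θ < 1) :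
    ∃ n : ℕ, (1 - θ) * Real.exp (θ * x) ≤ x ^ n / n.factorial := by
  by_contra! h
  set K := (1 - θ) * Real.exp (θ * x) with hK
  have h1 : HasSum (fun n : ℕ => (θ * x) ^ n / n.factorial) (Real.exp (θ * x)) := by
    rw [Real.exp_eq_exp_ℝ]
    exact NormedSpace.expSeries_div_hasSum_exp (θ * x)
  have h2 : HasSum (fun n : ℕ => θ ^ n * K) (Real.exp (θ * x)) := by
    have := (hasSum_geometric_of_lt_one hθ₀ hθ₁).mul_right K
    rwa [hK, inv_mul_cancel_left₀ (sub_pos.2 hθ₁).ne'] at this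
  refine (hasSum_lt (i := 0) (fun n => ?_) ?_ h1 h2).false
  · rw [mul_pow, mul_div_assoc]
    exact mul_le_mul_of_nonneg_left (h n).le (pow_nonneg hθ₀ n)
  · simpa using h 0

lemma RIQB.N_mono (X : RIQB) {g h : ℝ → ℝ≥0∞} (hg : AEMeasurable g volume)
    (hh : AEMeasurable h volume) (hgh : ∀ x, g x ≤ h x) : X.N g ≤ X.N h :=
  X.rearr_mono h g hh hg fun s _ => distRearr_mono hgh s

lemma RIQB.lt_top_of_antitoneOn (X : RIQB) {h : ℝ → ℝ≥0∞} (hm : AEMeasurable h volume)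
    (hh : AntitoneOn h (Ioi 0)) (hN : X.N h < ∞) {t : ℝ} (ht : 0 < t) : h t < ∞ := by
  by_contra htop
  have htop' : h t = ∞ := not_lt_top_iff.1 htop
  set e : ℝ → ℝ≥0∞ := (Ioo 0 t).indicator 1 with he
  have hem : Measurable e := measurable_one.indicator measurableSet_Ioo
  have hle : X.N (fun x => ∞ * e x) ≤ X.N h := by
    refine X.N_mono (hem.const_mul _).aemeasurable hm fun x => ?_
    by_cases hx : x ∈ Ioo 0 t
    · have : h x = ∞ := top_le_iff.1 (htop' ▸ hh hx.1 ht hx.2.le)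
      simp [this]
    · rw [he, indicator_of_notMem hx, mul_zero]
      exact zero_le
  have hne : X.N e ≠ 0 := by
    rw [Ne, X.definite e hem.aemeasurable, he, indicator_ae_eq_zero]
    simp [Function.support_one, ht]
  rw [X.norm_smul, ENNReal.top_mul hne] at hle
  exact (hle.trans_lt hN).false

/-- The iterates of the Hardy operator `H^{(p,r)}`, with values truncated to real numbers. -/
def hardyIter (p r : ℝ) (f : ℝ → ℝ) : ℕ → ℝ → ℝ
  | 0 => f
  | n + 1 => fun t => (hardyU p r (hardyIter p r f n) t).toReal

variable {X : RIQB} {p r C : ℝ}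

lemma hardyIter_mem (hp : 0 < p) (hr : 0 < r)
    (hbound : ∀ f : ℝ → ℝ, X.mem f → X.N (hardyU p r f) ≤ ENNReal.ofReal C * X.Nr f)
    {f : ℝ → ℝ} (hf : X.mem f) (n : ℕ) :
    X.mem (hardyIter p r f n) ∧
      X.Nr (hardyIter p r f n) ≤ ENNReal.ofReal C ^ n * X.Nr f := by
  induction n with
  | zero => exact ⟨hf, by simp [hardyIter]⟩
  | succ n ih =>
    have hm : AEMeasurable (hardyU p r (hardyIter p r f n)) volume :=
      hardyUE_measurable hr hp (distRearr_antitone _)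
    have hm' : AEMeasurable (hardyIter p r f (n + 1)) volume := hm.ennreal_toReal
    have hle : X.Nr (hardyIter p r f (n + 1)) ≤ X.N (hardyU p r (hardyIter p r f n)) := by
      refine X.N_mono (by fun_prop) hm fun x => ?_
      rw [hardyIter, abs_of_nonneg toReal_nonneg]
      exact ofReal_toReal_le
    have hle' : X.Nr (hardyIter p r f (n + 1)) ≤ ENNReal.ofReal C ^ (n + 1) * X.Nr f := by
      refine (hle.trans (hbound _ ih.1)).trans ?_
      rw [pow_succ', mul_assoc]
      gcongr
      exact ih.2
    exact ⟨⟨hm', hle'.trans_lt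
      (ENNReal.mul_lt_top (ENNReal.pow_lt_top ENNReal.ofReal_lt_top) hf.2)⟩, hle'⟩

lemma rearr_rpow_mul_le_hardyU_hardyIter (hp : 0 < p) (hr : 0 < r)
    (hbound : ∀ f : ℝ → ℝ, X.mem f → X.N (hardyU p r f) ≤ ENNReal.ofReal C * X.Nr f)
    {f : ℝ → ℝ} (hf : X.mem f) (n : ℕ) {y t : ℝ} (hy : 0 < y) (hyt : y < t) :
    rearr f y ^ r * ENNReal.ofReal
      ((y / t) ^ (r / p) * ((r / p * Real.log (t / y)) ^ n / n.factorial)) ≤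
        hardyU p r (hardyIter p r f n) t ^ r := by
  induction n generalizing t with
  | zero => simpa [hardyIter, hardyU] using
      le_hardyUE_rpow hr hp (g := rearr f) (distRearr_antitone _) hy hyt
  | succ n ih =>
    refine le_hardyUE_rpow_succ hr hp hy hyt n _ fun s hs => (ih hs).trans ?_
    have hs0 : 0 < s := hy.trans hs
    have hmem := (hardyIter_mem hp hr hbound hf n).1
    have hanti : Antitone (rearr (hardyIter p r f n)) := distRearr_antitone _
    have hfin : ∀ x, hardyU p r (hardyIter p r f n) x ≠ ∞ := fun x => by
      by_cases hx : 0 < x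
      · exact (X.lt_top_of_antitoneOn (hardyUE_measurable hr hp hanti)
          (hardyUE_antitoneOn hr hp hanti) ((hbound _ hmem).trans_lt
            (ENNReal.mul_lt_top ENNReal.ofReal_lt_top hmem.2)) hx).ne
      · simp [hardyU, hardyUE, hx]
    have heq : rearr (hardyIter p r f (n + 1)) = rearrE (hardyU p r (hardyIter p r f n)) := by
      unfold rearr
      congr 1
      ext x
      rw [hardyIter, abs_of_nonneg toReal_nonneg, ofReal_toReal (hfin x)]
    rw [heq]
    exact ENNReal.rpow_le_rpow (hardyUE_le_rearrE hr hp hanti hs0) hr.le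

lemma Nr_dil_le (hp : 0 < p) (hr : 0 < r)
    (hbound : ∀ f : ℝ → ℝ, X.mem f → X.N (hardyU p r f) ≤ ENNReal.ofReal C * X.Nr f)
    {f : ℝ → ℝ} (hf : X.mem f) (n : ℕ) {a w : ℝ} (ha₀ : 0 < a) (ha₁ : a < 1) (hw₀ : 0 < w)
    (hw : w ^ r ≤ a ^ (r / p) * ((r / p * -Real.log a) ^ n / n.factorial)) :
    ENNReal.ofReal w * X.Nr (dil a f) ≤ ENNReal.ofReal C ^ (n + 1) * X.Nr f := by
  obtain ⟨hmem, hle⟩ := hardyIter_mem hp hr hbound hf n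
  set h := hardyU p r (hardyIter p r f n)
  have hanti : Antitone (rearr (hardyIter p r f n)) := distRearr_antitone _
  have hm : AEMeasurable h volume := hardyUE_measurable hr hp hanti
  have hdm : AEMeasurable (dil a f) volume := by
    refine hf.1.comp_quasiMeasurePreserving ⟨measurable_const_mul a, ?_⟩
    rw [Real.map_volume_mul_left ha₀.ne']
    exact Measure.smul_absolutelyContinuous
  have hw₀' : ENNReal.ofReal w ≠ 0 := by simpa using hw₀
  have hpoint : ∀ s : ℝ, 0 < s → ENNReal.ofReal w * rearr (dil a f) s ≤ h s := by
    intro s hs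
    have hkey := rearr_rpow_mul_le_hardyU_hardyIter hp hr hbound hf n (mul_pos ha₀ hs)
      (mul_lt_of_lt_one_left hs ha₁)
    have e1 : a * s / s = a := mul_div_cancel_right₀ a hs.ne'
    have e2 : Real.log (s / (a * s)) = -Real.log a := by
      rw [div_mul_cancel_right₀ hs.ne', Real.log_inv]
    rw [e1, e2] at hkey
    rw [rearr_dil f ha₀, ← ENNReal.rpow_le_rpow_iff hr, ENNReal.mul_rpow_of_nonneg _ _ hr.le,
      ENNReal.ofReal_rpow_of_pos hw₀, mul_comm]
    refine le_trans ?_ hkey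
    gcongr
  calc ENNReal.ofReal w * X.Nr (dil a f)
      ≤ X.N h := by
        have hk := X.norm_smul (ENNReal.ofReal w)⁻¹ h
        have hmono : X.Nr (dil a f) ≤ X.N (fun x => (ENNReal.ofReal w)⁻¹ * h x) := by
          refine X.rearr_mono _ _ (hm.const_mul _) (by fun_prop) fun s hs => ?_
          refine le_trans ?_ (mul_distRearr_le (ENNReal.inv_ne_zero.2 ENNReal.ofReal_ne_top)
            (ENNReal.inv_ne_top.2 hw₀') h s)
          rw [← ENNReal.mul_le_iff_le_inv hw₀' ENNReal.ofReal_ne_top]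
          exact (hpoint s hs).trans (hardyUE_le_rearrE hr hp hanti hs)
        rwa [hk, ← ENNReal.mul_le_iff_le_inv hw₀' ENNReal.ofReal_ne_top] at hmono
    _ ≤ ENNReal.ofReal C * X.Nr (hardyIter p r f n) := hbound _ hmem
    _ ≤ ENNReal.ofReal C * (ENNReal.ofReal C ^ n * X.Nr f) := by gcongr
    _ = ENNReal.ofReal C ^ (n + 1) * X.Nr f := by rw [pow_succ', mul_assoc]

lemma ofReal_div_one_sub_le_lowerBoyd (hp : 0 < p) (hr : 0 < r) (hC : 1 < C)
    (hbound : ∀ f : ℝ → ℝ, X.mem f → X.N (hardyU p r f) ≤ ENNReal.ofReal C * X.Nr f)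
    {θ : ℝ} (hθ₀ : 0 < θ) (hθ₁ : θ < 1) :
    ENNReal.ofReal (p / (1 - θ * C ^ (-r))) ≤ lowerBoyd X := by
  have hC0 : 0 < C := by linarith
  have hCr0 : 0 < C ^ (-r) := Real.rpow_pos_of_pos hC0 _
  have hCr1 : C ^ (-r) < 1 := Real.rpow_lt_one_of_one_lt_of_neg hC (by linarith)
  have hb : 0 < 1 - θ * C ^ (-r) := by nlinarith
  refine le_iSup₂_of_le (p / (1 - θ * C ^ (-r)))
    ⟨by positivity, C * (1 - θ) ^ (-(1 / r)), ?_, fun a ha₀ ha₁ f hf hfN => ?_⟩ le_rfl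
  · have : 0 < 1 - θ := by linarith
    positivity
  have hθ : 0 < 1 - θ := by linarith
  set L : ℝ := r / p * -Real.log a with hL
  obtain ⟨n, hn⟩ := exists_exp_le_pow_div_factorial (x := L * C ^ (-r)) hθ₀.le hθ₁
  set c : ℝ := C * (1 - θ) ^ (-(1 / r)) * a ^ (-(1 / (p / (1 - θ * C ^ (-r))))) with hc
  have hc0 : 0 < c := by positivity
  have hw0 : 0 < C ^ (n + 1) / c := by positivity
  have hcr : c ^ r = C ^ r * (1 - θ)⁻¹ * a ^ (-(r / p * (1 - θ * C ^ (-r)))) := by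
    rw [hc, Real.mul_rpow (by positivity) (by positivity),
      Real.mul_rpow (by positivity) (by positivity), ← Real.rpow_mul hθ.le, ← Real.rpow_mul ha₀.le,
      ← Real.rpow_neg_one (1 - θ)]
    congr 3
    · field_simp
    · field_simp
  have hexp : a ^ (-(r / p * (1 - θ * C ^ (-r)))) =
      (a ^ (r / p))⁻¹ * (Real.exp (θ * (L * C ^ (-r))))⁻¹ := by
    rw [Real.rpow_def_of_pos ha₀, Real.rpow_def_of_pos ha₀, ← Real.exp_neg, ← Real.exp_neg,
      ← Real.exp_add, hL]
    congr 1
    ring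
  have hCn : (C ^ (n + 1)) ^ r = C ^ r * (C ^ r) ^ n := by
    rw [← Real.rpow_natCast, ← Real.rpow_mul hC0.le, ← Real.rpow_natCast (C ^ r),
      ← Real.rpow_mul hC0.le, ← Real.rpow_add hC0]
    push_cast
    ring_nf
  have hw : (C ^ (n + 1) / c) ^ r ≤ a ^ (r / p) * (L ^ n / n.factorial) := by
    rw [Real.div_rpow (by positivity) hc0.le, hcr, hexp, hCn]
    have hCrpos : 0 < C ^ r := Real.rpow_pos_of_pos hC0 _
    have hapos : 0 < a ^ (r / p) := Real.rpow_pos_of_pos ha₀ _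
    have hepos := Real.exp_pos (θ * (L * C ^ (-r)))
    calc _ = a ^ (r / p) * ((C ^ r) ^ n *
          ((1 - θ) * Real.exp (θ * (L * C ^ (-r))))) := by field_simp
      _ ≤ a ^ (r / p) * ((C ^ r) ^ n * ((L * C ^ (-r)) ^ n / n.factorial)) := by gcongr
      _ = a ^ (r / p) * (L ^ n / n.factorial) := by
        rw [Real.rpow_neg hC0.le, mul_pow, inv_pow]
        field_simp
  have key := Nr_dil_le hp hr hbound ⟨hf, hfN⟩ n ha₀ ha₁ hw0 hw
  rw [div_eq_mul_inv, ENNReal.ofReal_mul (by positivity), ENNReal.ofReal_pow hC0.le, mul_assoc,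
    ENNReal.mul_le_mul_iff_right (by simpa using hC0) (by simp), ENNReal.ofReal_inv_of_pos hc0,
    ENNReal.inv_mul_le_iff (by simpa using hc0) ENNReal.ofReal_ne_top] at key
  exact key

end Boyd

/-- **Theorem 2 (i), necessity.** If `H^{(p,r)}` is bounded on `X` with constant `C > 1`,
then `p_X ≥ p/(1 - C^{-r})`; in particular `p_X > p`. -/
theorem lowerBoyd_ge_of_hardyU_bounded (X : RIQB) (p r C : ℝ) (hp : 0 < p) (hr : 0 < r)
    (hC : 1 < C)
    (hbound : ∀ f : ℝ → ℝ, X.mem f → X.N (hardyU p r f) ≤ ENNReal.ofReal C * X.Nr f) :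
    ENNReal.ofReal (p / (1 - C ^ (-r))) ≤ lowerBoyd X ∧ ENNReal.ofReal p < lowerBoyd X := by
  have hCr0 : 0 < C ^ (-r) := Real.rpow_pos_of_pos (by linarith) _
  have hCr1 : C ^ (-r) < 1 := Real.rpow_lt_one_of_one_lt_of_neg hC (by linarith)
  have hmain : ENNReal.ofReal (p / (1 - C ^ (-r))) ≤ lowerBoyd X := by
    have hlim : Tendsto (fun θ : ℝ => ENNReal.ofReal (p / (1 - θ * C ^ (-r)))) (𝓝[<] 1)
        (𝓝 (ENNReal.ofReal (p / (1 - C ^ (-r))))) := by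
      have hcont : ContinuousAt (fun θ : ℝ => p / (1 - θ * C ^ (-r))) 1 :=
        ContinuousAt.div (by fun_prop) (by fun_prop) (by linarith)
      have := (ENNReal.tendsto_ofReal hcont.tendsto).mono_left
        (nhdsWithin_le_nhds (s := Iio (1:ℝ)))
      simpa only [one_mul] using this
    refine le_of_tendsto hlim ?_
    filter_upwards [Ioo_mem_nhdsLT (zero_lt_one (α := ℝ))] with θ hθ
    exact ofReal_div_one_sub_le_lowerBoyd hp hr hC hbound hθ.1 hθ.2
  refine ⟨hmain, lt_of_lt_of_le ?_ hmain⟩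
  have hlt : p < p / (1 - C ^ (-r)) := by
    rw [lt_div_iff₀ (by linarith)]
    nlinarith
  exact (ENNReal.ofReal_lt_ofReal_iff (hp.trans hlt)).2 hlt

end
end

section
/- Let X be a rearrangement invariant quasi-Banach space on ℝ, let 0 < q ≤ ∞ and 0 < r < ∞. If the Hardy operator H_{(q,r)} is bounded from X to X (i.e., there is a constant C such that ‖H_{(q,r)} f‖_X ≤ C ‖f‖_X for all f ∈ X), then the upper Boyd index satisfies q_X < q. -/
open MeasureTheory Set Filter Topology ENNReal

noncomputable section

/-- A function vanishing on `(-∞, 0]` that coincides with an antitone function on `(0, ∞)`. -/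
def IsHalfLineAntitone (F : ℝ → ℝ≥0∞) : Prop :=
  ∃ G : ℝ → ℝ≥0∞, Antitone G ∧ ∀ t, F t = if 0 < t then G t else 0

namespace IsHalfLineAntitone

variable {F : ℝ → ℝ≥0∞}

theorem measurable (hF : IsHalfLineAntitone F) : Measurable F := by
  obtain ⟨G, hG, hFG⟩ := hF
  rw [show F = fun t => if 0 < t then G t else 0 from funext hFG]
  exact Measurable.ite measurableSet_Ioi hG.measurable measurable_const

theorem le_of_le (hF : IsHalfLineAntitone F) {s t : ℝ} (hs : 0 < s) (hst : s ≤ t) :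
    F t ≤ F s := by
  obtain ⟨G, hG, hFG⟩ := hF
  rw [hFG, hFG, if_pos hs, if_pos (hs.trans_le hst)]
  exact hG hst

theorem const_mul (hF : IsHalfLineAntitone F) (k : ℝ≥0∞) :
    IsHalfLineAntitone fun t => k * F t := by
  obtain ⟨G, hG, hFG⟩ := hF
  refine ⟨fun t => k * G t, fun s t hst => mul_le_mul_right (hG hst) k, fun t => ?_⟩
  simp only [hFG]
  split_ifs <;> simp

theorem le_rearrE (hF : IsHalfLineAntitone F) {s t : ℝ} (hs : 0 < s) (hst : s < t) :
    F t ≤ rearrE F s := by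
  refine le_of_forall_lt fun c hc => ?_
  obtain ⟨d, hcd, hd⟩ := exists_between hc
  refine hcd.trans_le (le_sSup ?_)
  have hsub : Ioc 0 t ⊆ {x | d < F x} := fun x hx => hd.trans_le (hF.le_of_le hx.1 hx.2)
  calc ENNReal.ofReal s < ENNReal.ofReal t := by
        rw [ENNReal.ofReal_lt_ofReal_iff (hs.trans hst)]; exact hst
    _ = volume (Ioc 0 t) := by simp
    _ ≤ _ := measure_mono hsub

end IsHalfLineAntitone

theorem rearrE_mono {g h : ℝ → ℝ≥0∞} (hgh : ∀ x, g x ≤ h x) (s : ℝ) :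
    rearrE g s ≤ rearrE h s :=
  sSup_le_sSup fun _ ht => lt_of_lt_of_le ht (measure_mono fun x hx => lt_of_lt_of_le hx (hgh x))

theorem rearr_antitone (f : ℝ → ℝ) : Antitone (rearr f) := fun _ _ hst =>
  sSup_le_sSup fun _ ht => lt_of_le_of_lt (ENNReal.ofReal_le_ofReal hst) ht

theorem rearr_dil_le {a : ℝ} (ha : 0 < a) (f : ℝ → ℝ) (s : ℝ) :
    rearr (dil a f) s ≤ rearr f (a * s) := by
  refine sSup_le_sSup fun t ht => ?_
  change ENNReal.ofReal s < volume ((a * ·) ⁻¹' {x | t < ENNReal.ofReal |f x|}) at ht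
  change ENNReal.ofReal (a * s) < volume {x | t < ENNReal.ofReal |f x|}
  rw [Real.volume_preimage_mul_left ha.ne', abs_of_pos (inv_pos.2 ha)] at ht
  by_contra! hcon
  refine ht.not_ge ((mul_le_mul_right hcon _).trans ?_)
  rw [← ENNReal.ofReal_mul (inv_pos.2 ha).le, inv_mul_cancel_left₀ ha.ne']

theorem le_rearr_dil {a : ℝ} (ha : 0 < a) (f : ℝ → ℝ) (s : ℝ) :
    rearr f (a * s) ≤ rearr (dil a f) s := by
  have h := rearr_dil_le (inv_pos.2 ha) (dil a f) (a * s)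
  rwa [inv_mul_cancel_left₀ ha.ne', show dil a⁻¹ (dil a f) = f by
    funext x; simp [dil, mul_inv_cancel_left₀ ha.ne']] at h

theorem aemeasurable_dil {a : ℝ} (ha : a ≠ 0) {f : ℝ → ℝ} (hf : AEMeasurable f volume) :
    AEMeasurable (dil a f) volume := by
  refine hf.comp_quasiMeasurePreserving ⟨measurable_const_mul a, ?_⟩
  rw [Real.map_volume_mul_left ha]
  exact Measure.smul_absolutelyContinuous

theorem aemeasurable_ofReal_abs {f : ℝ → ℝ} (hf : AEMeasurable f volume) :
    AEMeasurable (fun x => ENNReal.ofReal |f x|) volume :=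
  (continuous_abs.measurable.comp_aemeasurable hf).ennreal_ofReal

namespace RIQB

variable (X : RIQB)

theorem Nr_dil_le_of_rearr_le {a : ℝ} (ha : 0 < a) {f : ℝ → ℝ} (hf : AEMeasurable f volume)
    {F : ℝ → ℝ≥0∞} (hF : IsHalfLineAntitone F) (k : ℝ≥0∞)
    (h : ∀ s, 0 < s → rearr f (a * s) ≤ k * F (2 * s)) :
    X.Nr (dil a f) ≤ k * X.N F := by
  rw [← X.norm_smul]
  refine X.rearr_mono _ _ (hF.const_mul k).measurable.aemeasurable
    (aemeasurable_ofReal_abs (aemeasurable_dil ha.ne' hf)) fun s hs => ?_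
  exact (rearr_dil_le ha f s).trans ((h s hs).trans
    ((hF.const_mul k).le_rearrE hs (by linarith)))

theorem Nr_dil_anti {a b : ℝ} (ha : 0 < a) (hab : a ≤ b) {f : ℝ → ℝ}
    (hf : AEMeasurable f volume) : X.Nr (dil b f) ≤ X.Nr (dil a f) := by
  refine X.rearr_mono _ _ (aemeasurable_ofReal_abs (aemeasurable_dil ha.ne' hf))
    (aemeasurable_ofReal_abs (aemeasurable_dil (ha.trans_le hab).ne' hf)) fun s hs => ?_
  exact (rearr_dil_le (ha.trans_le hab) f s).trans
    ((rearr_antitone f (by gcongr)).trans (le_rearr_dil ha f s))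

theorem ne_top_of_N_lt_top {F : ℝ → ℝ≥0∞} (hF : IsHalfLineAntitone F) (hN : X.N F < ∞) (t : ℝ) :
    F t ≠ ∞ := by
  intro htop
  have ht : 0 < t := by
    by_contra hneg
    obtain ⟨G, -, hFG⟩ := hF
    rw [hFG, if_neg hneg] at htop
    exact ENNReal.zero_ne_top htop
  set u : ℝ → ℝ≥0∞ := (Ioo 0 t).indicator 1 with hu
  have hum : Measurable u := measurable_one.indicator measurableSet_Ioo
  have hle : X.N (fun x => ∞ * u x) ≤ X.N F := by
    refine X.rearr_mono _ _ hF.measurable.aemeasurable (hum.const_mul _).aemeasurable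
      fun s _ => rearrE_mono (fun x => ?_) s
    by_cases hx : x ∈ Ioo 0 t
    · have := hF.le_of_le hx.1 hx.2.le
      rw [htop] at this
      exact le_top.trans this
    · simp [hu, hx]
  rw [X.norm_smul] at hle
  have h0 : X.N u ≠ 0 := by
    rw [Ne, X.definite u hum.aemeasurable, hu, indicator_ae_eq_zero]
    simp [ht]
  rw [ENNReal.top_mul h0] at hle
  exact hN.not_ge hle

theorem Nr_dil_pow_le {a k : ℝ} (ha : 0 < a)
    (H : ∀ f, X.mem f → X.Nr (dil a f) ≤ ENNReal.ofReal k * X.Nr f) {f : ℝ → ℝ}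
    (hf : X.mem f) (n : ℕ) : X.Nr (dil (a ^ n) f) ≤ ENNReal.ofReal k ^ n * X.Nr f := by
  induction n with
  | zero => simp [dil, RIQB.Nr]
  | succ n ih =>
    have hmem : X.mem (dil (a ^ n) f) := ⟨aemeasurable_dil (pow_pos ha n).ne' hf.1,
      ih.trans_lt (ENNReal.mul_lt_top (ENNReal.pow_lt_top ENNReal.ofReal_lt_top) hf.2)⟩
    have heq : dil (a ^ (n + 1)) f = dil a (dil (a ^ n) f) := by
      funext x; simp only [dil]; congr 1; ring
    rw [heq, pow_succ', mul_assoc]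
    exact (H _ hmem).trans (mul_le_mul_right ih _)

theorem upperBoyd_le_of_dil_le {a b : ℝ} (ha : 1 < a) (hb : 0 < b)
    (H : ∀ f, X.mem f → X.Nr (dil a f) ≤ ENNReal.ofReal (a ^ (-b)) * X.Nr f) :
    upperBoyd X ≤ ENNReal.ofReal (1 / b) := by
  have ha0 : 0 < a := one_pos.trans ha
  refine iInf₂_le (1 / b) ⟨by positivity, a ^ b, by positivity, fun x hx f hf hNf => ?_⟩
  rw [one_div_one_div]
  obtain ⟨n, hn, hn'⟩ := exists_nat_pow_near hx.le ha
  refine (X.Nr_dil_anti (pow_pos ha0 n) hn hf).trans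
    ((X.Nr_dil_pow_le ha0 H ⟨hf, hNf⟩ n).trans (mul_le_mul_left ?_ _))
  rw [← ENNReal.ofReal_pow (by positivity)]
  refine ENNReal.ofReal_le_ofReal ?_
  have h1 : (a ^ (n + 1)) ^ (-b) ≤ x ^ (-b) :=
    Real.rpow_le_rpow_of_nonpos (one_pos.trans hx) hn'.le (by linarith)
  have h2 : (a ^ (-b)) ^ n = a ^ b * (a ^ (n + 1)) ^ (-b) := by
    rw [← Real.rpow_natCast, ← Real.rpow_natCast, ← Real.rpow_mul ha0.le, ← Real.rpow_mul ha0.le,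
      ← Real.rpow_add ha0]
    congr 1; push_cast; ring
  rw [h2]
  gcongr

theorem exists_upperBoyd_le_of_dil_log_decay {β r c D : ℝ} (hβ : 0 ≤ β) (hr : 0 < r)
    (hc : 0 < c) (hD : 0 < D)
    (H : ∀ a, 8 < a → ∀ f, X.mem f → X.Nr (dil a f) ≤
      ENNReal.ofReal ((c * Real.log (a / 8) * a ^ (r * β)) ^ (-(1 / r)) * D) * X.Nr f) :
    ∃ b, β < b ∧ upperBoyd X ≤ ENNReal.ofReal (1 / b) := by
  set M : ℝ := (2 * D) ^ r with hM
  have hM0 : 0 < M := by positivity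
  set a : ℝ := 8 * Real.exp (M / c) with ha
  have ha8 : 8 < a := by
    have : 1 < Real.exp (M / c) := Real.one_lt_exp_iff.2 (by positivity)
    linarith
  have ha0 : 0 < a := by linarith
  have hla : 0 < Real.log a := Real.log_pos (by linarith)
  have hl2 : 0 < Real.log 2 := Real.log_pos (by norm_num)
  have hb : β < β + Real.log 2 / Real.log a := by
    have := div_pos hl2 hla
    linarith
  refine ⟨_, hb, X.upperBoyd_le_of_dil_le (a := a) (by linarith) (hβ.trans_lt hb) fun f hf => ?_⟩
  refine (H a ha8 f hf).trans (mul_le_mul_left (ENNReal.ofReal_le_ofReal (le_of_eq ?_)) _)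
  have h1 : c * Real.log (a / 8) = M := by
    rw [ha, mul_div_cancel_left₀ _ (by norm_num), Real.log_exp]; field_simp
  have h2 : a ^ (-(Real.log 2 / Real.log a)) = 2⁻¹ := by
    rw [Real.rpow_def_of_pos ha0, mul_neg, mul_div_cancel₀ _ hla.ne', Real.exp_neg,
      Real.exp_log two_pos]
  have h3 : (M * a ^ (r * β)) ^ (-(1 / r)) = (2 * D)⁻¹ * a ^ (-β) := by
    rw [hM, Real.mul_rpow (by positivity) (by positivity), ← Real.rpow_mul (by positivity),
      ← Real.rpow_mul ha0.le, show r * -(1 / r) = -1 by field_simp, Real.rpow_neg_one]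
    congr 2; field_simp
  rw [h1, h3, neg_add, Real.rpow_add ha0, h2]
  field_simp

end RIQB

theorem le_rpow_mul_of_mul_rpow_le {K r : ℝ} (hK : 0 < K) (hr : 0 < r) {x y : ℝ≥0∞}
    (h : ENNReal.ofReal K * x ^ r ≤ y ^ r) : x ≤ ENNReal.ofReal (K ^ (-(1 / r))) * y := by
  rw [← ENNReal.rpow_le_rpow_iff hr, ENNReal.mul_rpow_of_nonneg _ _ hr.le,
    ENNReal.ofReal_rpow_of_pos (by positivity), ← Real.rpow_mul hK.le,
    show -(1 / r) * r = -1 by field_simp, Real.rpow_neg_one]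
  calc x ^ r = ENNReal.ofReal K⁻¹ * (ENNReal.ofReal K * x ^ r) := by
        rw [← mul_assoc, ← ENNReal.ofReal_mul (by positivity), inv_mul_cancel₀ hK.ne']; simp
    _ ≤ _ := mul_le_mul_right h _

theorem isHalfLineAntitone_hardyL {q r : ℝ} (hq : 0 < q) (hr : 0 < r) (f : ℝ → ℝ) :
    IsHalfLineAntitone (hardyL q r f) := by
  refine ⟨_, fun s t hst => ?_, fun t => rfl⟩
  have h1 : ENNReal.ofReal t ^ (-(1 / q)) ≤ ENNReal.ofReal s ^ (-(1 / q)) := by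
    rw [ENNReal.rpow_neg, ENNReal.rpow_neg]
    gcongr
  exact mul_le_mul' h1 (ENNReal.rpow_le_rpow
    (mul_le_mul_right (lintegral_mono_set (Ioi_subset_Ioi hst)) _) (by positivity))

theorem isHalfLineAntitone_hardyLInf {r : ℝ} (hr : 0 < r) (f : ℝ → ℝ) :
    IsHalfLineAntitone (hardyLInf r f) :=
  ⟨_, fun _ _ hst => ENNReal.rpow_le_rpow (lintegral_mono_set (Ioi_subset_Ioi hst))
    (by positivity), fun _ => rfl⟩

theorem hardyL_rpow {q r : ℝ} (hr : 0 < r) (f : ℝ → ℝ) {t : ℝ} (ht : 0 < t) :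
    hardyL q r f t ^ r = ENNReal.ofReal (t ^ (-(r / q)) * (r / q)) *
      ∫⁻ s in Ioi t, rearr f s ^ r * ENNReal.ofReal (s ^ (r / q - 1)) := by
  rw [hardyL, if_pos ht, ENNReal.mul_rpow_of_nonneg _ _ hr.le, ← ENNReal.rpow_mul,
    ← ENNReal.rpow_mul, one_div_mul_cancel hr.ne', ENNReal.rpow_one,
    ENNReal.ofReal_rpow_of_pos ht, ENNReal.ofReal_mul (by positivity), mul_assoc]
  congr 3
  ring_nf

theorem hardyLInf_rpow {r : ℝ} (hr : 0 < r) (f : ℝ → ℝ) {t : ℝ} (ht : 0 < t) :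
    hardyLInf r f t ^ r = ∫⁻ s in Ioi t, rearr f s ^ r * ENNReal.ofReal s⁻¹ := by
  rw [hardyLInf, if_pos ht, ← ENNReal.rpow_mul, one_div_mul_cancel hr.ne', ENNReal.rpow_one]

theorem lintegral_Ioc_inv {x y : ℝ} (hx : 0 < x) (hxy : x ≤ y) :
    ∫⁻ s in Ioc x y, ENNReal.ofReal s⁻¹ = ENNReal.ofReal (Real.log (y / x)) := by
  have hpos : ∀ s ∈ Ioc x y, 0 < s := fun s hs => hx.trans hs.1
  rw [← integral_inv_of_pos hx (hx.trans_le hxy), intervalIntegral.integral_of_le hxy,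
    ofReal_integral_eq_lintegral_ofReal]
  · refine (intervalIntegrable_iff_integrableOn_Ioc_of_le hxy).1 <|
      intervalIntegral.intervalIntegrable_inv (fun s hs => ?_) continuousOn_id
    rw [uIcc_of_le hxy] at hs
    exact (hx.trans_le hs.1).ne'
  · exact (ae_restrict_mem measurableSet_Ioc).mono fun s hs => (inv_pos.2 (hpos s hs)).le

theorem mul_log_le_lintegral_Ioi {x y : ℝ} (hx : 0 < x) (hxy : x ≤ y) (A : ℝ≥0∞)
    {u : ℝ → ℝ≥0∞} (hu : ∀ s ∈ Ioc x y, A * ENNReal.ofReal s⁻¹ ≤ u s) :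
    A * ENNReal.ofReal (Real.log (y / x)) ≤ ∫⁻ s in Ioi x, u s := by
  rw [← lintegral_Ioc_inv hx hxy, ← lintegral_const_mul _ (by fun_prop)]
  exact (setLIntegral_mono' measurableSet_Ioc hu).trans (lintegral_mono_set Ioc_subset_Ioi_self)

theorem log_mul_rearr_le_hardyLInf {r : ℝ} (hr : 0 < r) (f : ℝ → ℝ) {t T : ℝ} (ht : 0 < t)
    (hT : t ≤ T) :
    ENNReal.ofReal (Real.log (T / t)) * rearr f T ^ r ≤ hardyLInf r f t ^ r := by
  rw [hardyLInf_rpow hr f ht, mul_comm]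
  refine mul_log_le_lintegral_Ioi ht hT _ fun s hs => ?_
  gcongr
  exact rearr_antitone f hs.2

theorem mul_rearr_le_hardyL {q r : ℝ} (hq : 0 < q) (hr : 0 < r) (f : ℝ → ℝ) {x T : ℝ}
    (hx : 0 < x) (hT : x ≤ T) :
    ENNReal.ofReal (x ^ (-(r / q)) * (r / q) * (T ^ (r / q) / 2)) * rearr f (2 * T) ^ r ≤
      hardyL q r f x ^ r := by
  have hT0 : 0 < T := hx.trans_le hT
  rw [hardyL_rpow hr f hx, ENNReal.ofReal_mul (by positivity), mul_assoc]
  refine mul_le_mul_right ?_ _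
  calc ENNReal.ofReal (T ^ (r / q) / 2) * rearr f (2 * T) ^ r
      = ∫⁻ _ in Ioc T (2 * T), rearr f (2 * T) ^ r *
          ENNReal.ofReal (T ^ (r / q) * (2 * T)⁻¹) := by
        rw [setLIntegral_const, Real.volume_Ioc, mul_assoc, ← ENNReal.ofReal_mul (by positivity),
          mul_comm]
        congr 2
        field_simp
        ring
    _ ≤ ∫⁻ s in Ioc T (2 * T), rearr f s ^ r * ENNReal.ofReal (s ^ (r / q - 1)) := by
        refine setLIntegral_mono' measurableSet_Ioc fun s hs => ?_
        have hs0 : 0 < s := hT0.trans hs.1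
        refine mul_le_mul' (ENNReal.rpow_le_rpow (rearr_antitone f hs.2) hr.le)
          (ENNReal.ofReal_le_ofReal ?_)
        rw [Real.rpow_sub_one hs0.ne', div_eq_mul_inv]
        have h1 := hs.1.le
        have h2 := hs.2
        exact mul_le_mul (Real.rpow_le_rpow hT0.le h1 (by positivity))
          (inv_anti₀ hs0 h2) (by positivity) (by positivity)
    _ ≤ _ := lintegral_mono_set fun s hs => hT.trans_lt hs.1

theorem mul_log_mul_rearr_le_hardyL_hardyL {q r : ℝ} (hq : 0 < q) (hr : 0 < r) {f g : ℝ → ℝ}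
    (hg : ∀ s t, 0 < s → s < t → hardyL q r f t ≤ rearr g s) {t T : ℝ} (ht : 0 < t)
    (hT : 2 * t ≤ T) :
    ENNReal.ofReal (t ^ (-(r / q)) * (r / q) *
      (2 ^ (-(r / q)) * (r / q) * (T ^ (r / q) / 2) * Real.log (T / 2 / t))) *
        rearr f (2 * T) ^ r ≤ hardyL q r g t ^ r := by
  have hT0 : 0 < T := by linarith
  rw [hardyL_rpow hr g ht, ENNReal.ofReal_mul (by positivity), mul_assoc]
  refine mul_le_mul_right ?_ _
  rw [ENNReal.ofReal_mul (by positivity), mul_right_comm]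
  refine mul_log_le_lintegral_Ioi ht (by linarith) _ fun s hs => ?_
  have hs0 : 0 < s := ht.trans hs.1
  have h1 := (mul_rearr_le_hardyL hq hr f (x := 2 * s) (T := T) (by positivity)
    (by linarith [hs.2])).trans
    (ENNReal.rpow_le_rpow (hg s (2 * s) hs0 (by linarith)) hr.le)
  refine le_trans (le_of_eq ?_) (mul_le_mul_left h1 _)
  rw [mul_right_comm, mul_right_comm _ (rearr f (2 * T) ^ r), ← ENNReal.ofReal_mul (by positivity),
    ← ENNReal.ofReal_mul (by positivity)]
  congr 2
  rw [Real.mul_rpow two_pos.le hs0.le, Real.rpow_sub_one hs0.ne', Real.rpow_neg hs0.le]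
  field_simp

theorem RIQB.Nr_dil_le_of_hardyLInf_bounded (X : RIQB) {r C : ℝ} (hr : 0 < r)
    (hbound : ∀ f, X.mem f → X.N (hardyLInf r f) ≤ ENNReal.ofReal C * X.Nr f)
    {a : ℝ} (ha : 8 < a) {f : ℝ → ℝ} (hf : X.mem f) :
    X.Nr (dil a f) ≤
      ENNReal.ofReal ((1 * Real.log (a / 8) * a ^ (r * 0)) ^ (-(1 / r)) * C) * X.Nr f := by
  have hlog : 0 < Real.log (a / 8) := Real.log_pos (by rw [lt_div_iff₀] <;> linarith)
  rw [ENNReal.ofReal_mul (by positivity), mul_assoc]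
  refine (X.Nr_dil_le_of_rearr_le (by linarith) hf.1 (isHalfLineAntitone_hardyLInf hr f) _
    fun s hs => le_rpow_mul_of_mul_rpow_le (by positivity) hr ?_).trans
    (mul_le_mul_right (hbound f hf) _)
  refine le_trans (mul_le_mul_left (ENNReal.ofReal_le_ofReal ?_) _)
    (log_mul_rearr_le_hardyLInf hr f (t := 2 * s) (T := a * s) (by positivity) (by nlinarith))
  rw [mul_div_mul_right _ _ hs.ne', one_mul, mul_zero, Real.rpow_zero, mul_one]
  exact Real.log_le_log (by linarith) (by linarith)

theorem RIQB.Nr_dil_le_of_hardyL_bounded (X : RIQB) {q r C : ℝ} (hq : 0 < q) (hr : 0 < r)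
    (hC : 0 < C) (hbound : ∀ f, X.mem f → X.N (hardyL q r f) ≤ ENNReal.ofReal C * X.Nr f)
    {a : ℝ} (ha : 8 < a) {f : ℝ → ℝ} (hf : X.mem f) :
    X.Nr (dil a f) ≤
      ENNReal.ofReal (((r / q) ^ 2 * 8 ^ (-(r / q)) / 2 * Real.log (a / 8) *
        a ^ (r * (1 / q))) ^ (-(1 / r)) * C ^ 2) * X.Nr f := by
  have hlog : 0 < Real.log (a / 8) := Real.log_pos (by rw [lt_div_iff₀] <;> linarith)
  have ha0 : 0 < a := by linarith
  have hF := isHalfLineAntitone_hardyL hq hr f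
  have hFN := hbound f hf
  have hFtop : X.N (hardyL q r f) < ∞ :=
    hFN.trans_lt (ENNReal.mul_lt_top ENNReal.ofReal_lt_top hf.2)
  set g : ℝ → ℝ := fun x => (hardyL q r f x).toReal with hgdef
  have hgE : (fun x => ENNReal.ofReal |g x|) = hardyL q r f := by
    funext x
    rw [hgdef, abs_of_nonneg ENNReal.toReal_nonneg,
      ENNReal.ofReal_toReal (X.ne_top_of_N_lt_top hF hFtop x)]
  have hgN : X.Nr g = X.N (hardyL q r f) := by rw [RIQB.Nr, hgE]
  have hg : X.mem g := ⟨hF.measurable.ennreal_toReal.aemeasurable, hgN ▸ hFtop⟩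
  have hle : ∀ s t, 0 < s → s < t → hardyL q r f t ≤ rearr g s := fun s t hs hst => by
    rw [rearr, hgE]
    exact hF.le_rearrE hs hst
  have hNN : X.N (hardyL q r g) ≤ ENNReal.ofReal (C ^ 2) * X.Nr f := by
    rw [ENNReal.ofReal_pow hC.le, pow_two, mul_assoc]
    exact (hbound g hg).trans (mul_le_mul_right (hgN ▸ hFN) _)
  rw [ENNReal.ofReal_mul (by positivity), mul_assoc]
  refine (X.Nr_dil_le_of_rearr_le ha0 hf.1 (isHalfLineAntitone_hardyL hq hr g) _
    fun s hs => le_rpow_mul_of_mul_rpow_le (by positivity) hr ?_).trans (mul_le_mul_right hNN _)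
  have key := mul_log_mul_rearr_le_hardyL_hardyL hq hr hle (t := 2 * s) (T := a * s / 2)
    (by positivity) (by nlinarith)
  rw [mul_div_cancel₀ _ two_ne_zero] at key
  refine le_trans (le_of_eq ?_) key
  congr 2
  rw [show a * s / 2 / 2 / (2 * s) = a / 8 by field_simp; norm_num,
    show r * (1 / q) = r / q by ring, show a * s / 2 = a * (s / 2) by ring,
    Real.mul_rpow ha0.le (by positivity), Real.mul_rpow two_pos.le hs.le,
    Real.div_rpow hs.le two_pos.le, show (8 : ℝ) = 2 * 2 * 2 by norm_num,
    Real.mul_rpow (by norm_num) (by norm_num), Real.mul_rpow (by norm_num) (by norm_num),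
    Real.rpow_neg two_pos.le, Real.rpow_neg hs.le]
  field_simp

/-- **Theorem 2 (ii), necessity.** If `H_{(q,r)}` (with `0 < q ≤ ∞`) is bounded on `X`
then `q_X < q`. -/
theorem upperBoyd_lt_of_hardyL_bounded (X : RIQB) (q : ℝ≥0∞) (r C : ℝ) (hq : 0 < q)
    (hr : 0 < r)
    (hbound : ∀ f : ℝ → ℝ, X.mem f → X.N (hardyLG q r f) ≤ ENNReal.ofReal C * X.Nr f) :
    upperBoyd X < q := by
  have hC : 0 < max C 1 := lt_max_of_lt_right one_pos
  have hbound' : ∀ f, X.mem f →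
      X.N (hardyLG q r f) ≤ ENNReal.ofReal (max C 1) * X.Nr f := fun f hf =>
    (hbound f hf).trans (mul_le_mul_left (ENNReal.ofReal_le_ofReal (le_max_left _ _)) _)
  by_cases hqt : q = ∞
  · simp only [hardyLG, if_pos hqt] at hbound'
    obtain ⟨b, -, hb⟩ := X.exists_upperBoyd_le_of_dil_log_decay le_rfl hr one_pos hC
      fun a ha f hf => X.Nr_dil_le_of_hardyLInf_bounded hr hbound' ha hf
    exact hqt ▸ hb.trans_lt ENNReal.ofReal_lt_top
  · simp only [hardyLG, if_neg hqt] at hbound'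
    have hq0 : 0 < q.toReal := ENNReal.toReal_pos hq.ne' hqt
    obtain ⟨b, hb, hXb⟩ := X.exists_upperBoyd_le_of_dil_log_decay
      (one_div_pos.2 hq0).le hr (by positivity) (pow_pos hC 2)
      fun a ha f hf => X.Nr_dil_le_of_hardyL_bounded hq0 hr hC hbound' ha hf
    refine hXb.trans_lt ((ENNReal.ofReal_lt_iff_lt_toReal ?_ hqt).2 ?_)
    · exact (one_div_pos.2 ((one_div_pos.2 hq0).trans hb)).le
    · rwa [one_div_lt ((one_div_pos.2 hq0).trans hb) hq0]

end
end
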